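/- Let M be a MAG and P its PAG (so M ∈ [P]), and let X, Y, Z be pairwise disjoint node sets with X and Y nonempty. Suppose P is adjustment amenable relative to (X,Y) and Z ∩ Forb(X,Y,P) = ∅. Let p be a shortest proper non-causal path from X to Y that is m-connecting given Z in M, such that no equally short such path has a shorter distance-from-Z than p. Then for every collider Q on p and every shortest directed path d in M from Q to a member of Z, the path in P with the same node sequence as d is a directed path; consequently every collider on the path p* in P with the same node sequence as p has a descendant in Z in P. -/

import Mathlib

open scoped Classical

/-- Edge marks: tail, arrowhead, circle. -/
inductive Mark : Type
  | tail
  | arrow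
  | circle
  deriving DecidableEq

/-- A partial mixed graph over a node set `V`: any two distinct nodes are joined by
at most one edge; `mark a b` is the mark at `b` on the edge between `a` and `b`
(`none` if there is no edge). -/
structure PMG (V : Type) where
  mark : V → V → Option Mark
  symm : ∀ a b, (mark a b).isSome ↔ (mark b a).isSome
  irrefl : ∀ a, mark a a = none

namespace PMG

variable {V : Type}

/-- `a` and `b` are adjacent. -/
def Adj (G : PMG V) (a b : V) : Prop := (G.mark a b).isSome

/-- directed edge `a → b`. -/
def DirEdge (G : PMG V) (a b : V) : Prop :=
  G.mark a b = some Mark.arrow ∧ G.mark b a = some Mark.tail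

/-- bidirected edge `a ↔ b`. -/
def BidirEdge (G : PMG V) (a b : V) : Prop :=
  G.mark a b = some Mark.arrow ∧ G.mark b a = some Mark.arrow

/-- non-directed edge `a o-o b`. -/
def NondirEdge (G : PMG V) (a b : V) : Prop :=
  G.mark a b = some Mark.circle ∧ G.mark b a = some Mark.circle

/-- A path: a nonempty list of distinct nodes in which successive nodes are adjacent. -/
def IsPath (G : PMG V) (p : List V) : Prop :=
  p ≠ [] ∧ p.Nodup ∧ p.Chain' G.Adj

/-- A path from `a` to `b` (with at least one edge). -/
def IsPathFromTo (G : PMG V) (p : List V) (a b : V) : Prop :=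
  IsPath G p ∧ p.head? = some a ∧ p.getLast? = some b ∧ 2 ≤ p.length

/-- All edges on `p` are directed towards the end of `p`. -/
def DirectedAlong (G : PMG V) (p : List V) : Prop :=
  ∀ i a b, p[i]? = some a → p[i+1]? = some b → G.DirEdge a b

/-- No edge on `p` has an arrowhead at its endpoint closer to the start of `p`
(`p` is possibly directed). -/
def PossDirAlong (G : PMG V) (p : List V) : Prop :=
  ∀ i a b, p[i]? = some a → p[i+1]? = some b → G.mark b a ≠ some Mark.arrow

/-- `b` is a descendant of `a`: a directed path (possibly of length 0) from `a` to `b`. -/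
def Descendant (G : PMG V) (a b : V) : Prop :=
  ∃ p, IsPath G p ∧ DirectedAlong G p ∧ p.head? = some a ∧ p.getLast? = some b

/-- `b` is a possible descendant of `a`. -/
def PossDescendant (G : PMG V) (a b : V) : Prop :=
  ∃ p, IsPath G p ∧ PossDirAlong G p ∧ p.head? = some a ∧ p.getLast? = some b

/-- The node at position `i+1` of `p` is a collider on `p`. -/
def ColliderAt (G : PMG V) (p : List V) (i : ℕ) : Prop :=
  ∃ a b c, p[i]? = some a ∧ p[i+1]? = some b ∧ p[i+2]? = some c ∧
    G.mark a b = some Mark.arrow ∧ G.mark c b = some Mark.arrow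

/-- The node at position `i+1` of `p` is a definite non-collider on `p`. -/
def DefNonColliderAt (G : PMG V) (p : List V) (i : ℕ) : Prop :=
  ∃ a b c, p[i]? = some a ∧ p[i+1]? = some b ∧ p[i+2]? = some c ∧
    (G.mark a b = some Mark.tail ∨ G.mark c b = some Mark.tail ∨
      (G.mark a b = some Mark.circle ∧ G.mark c b = some Mark.circle ∧ ¬ G.Adj a c))

/-- `p` is of definite status. -/
def DefStatus (G : PMG V) (p : List V) : Prop :=
  ∀ i, i + 2 < p.length → (ColliderAt G p i ∨ DefNonColliderAt G p i)

/-- `p` is a definite status path that is m-connecting given `Z`. -/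
def MConn (G : PMG V) (Z : Finset V) (p : List V) : Prop :=
  DefStatus G p ∧
  (∀ i b, p[i+1]? = some b → DefNonColliderAt G p i → b ∉ Z) ∧
  (∀ i b, p[i+1]? = some b → ColliderAt G p i → ∃ z ∈ Z, Descendant G b z)

/-- `a` and `b` are m-separated given `Z`: every definite status path between them
is blocked by `Z`. -/
def MSep (G : PMG V) (a b : V) (Z : Finset V) : Prop :=
  ∀ p, IsPathFromTo G p a b → ¬ MConn G Z p

/-- Two graphs have the same m-separation relations. -/
def MarkovEquiv (G H : PMG V) : Prop :=
  ∀ a b (Z : Finset V), a ≠ b → a ∉ Z → b ∉ Z → (MSep G a b Z ↔ MSep H a b Z)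

/-- `G` is a DAG: all edges directed and no directed cycle. -/
def IsDAG (G : PMG V) : Prop :=
  (∀ a b, G.Adj a b → G.DirEdge a b ∨ G.DirEdge b a) ∧
  (∀ a b, Descendant G a b → Descendant G b a → a = b)

/-- A mixed graph: edges only `→` or `↔`. -/
def IsMixed (G : PMG V) : Prop :=
  ∀ a b, G.Adj a b → G.DirEdge a b ∨ G.DirEdge b a ∨ G.BidirEdge a b

/-- Ancestral mixed graph: no directed cycle, no almost directed cycle. -/
def IsAncestral (G : PMG V) : Prop :=
  IsMixed G ∧ (∀ a b, Descendant G a b → Descendant G b a → a = b) ∧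
  (∀ a b, Descendant G a b → ¬ G.BidirEdge b a)

/-- Maximal ancestral graph. -/
def IsMAG (G : PMG V) : Prop :=
  IsAncestral G ∧ ∀ a b : V, a ≠ b → ¬ G.Adj a b →
    ∃ Z : Finset V, a ∉ Z ∧ b ∉ Z ∧ MSep G a b Z

/-- A collider path from `v` to `x` that is into `x` and all of whose
non-endpoint nodes are parents of `y`. -/
def ColliderPathInto (G : PMG V) (v x y : V) : Prop :=
  ∃ p : List V, IsPathFromTo G p v x ∧
    (∀ i, i + 2 < p.length → ColliderAt G p i) ∧
    (∃ a, p[p.length - 2]? = some a ∧ G.mark a x = some Mark.arrow) ∧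
    (∀ c ∈ p, c ≠ v → c ≠ x → G.DirEdge c y)

/-- The directed edge `x → y` is visible (in a MAG or PAG). -/
def Visible (G : PMG V) (x y : V) : Prop :=
  G.DirEdge x y ∧
  ∃ v, v ≠ y ∧ ¬ G.Adj v y ∧
    (G.mark v x = some Mark.arrow ∨ ColliderPathInto G v x y)

/-- `p` is a proper path from the node set `X` to the node set `Y`. -/
def ProperPath (G : PMG V) (X Y : Finset V) (p : List V) : Prop :=
  IsPath G p ∧ (∃ a ∈ X, p.head? = some a) ∧ (∃ b ∈ Y, p.getLast? = some b) ∧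
  (∀ c ∈ p.tail, c ∉ X)

/-- `p` starts with an edge satisfying `vis` out of its first node. -/
def StartsVisible (vis : V → V → Prop) (p : List V) : Prop :=
  ∃ a b, p[0]? = some a ∧ p[1]? = some b ∧ vis a b

/-- Adjustment amenability relative to `(X,Y)`, with visibility predicate `vis`. -/
def Amenable (G : PMG V) (vis : V → V → Prop) (X Y : Finset V) : Prop :=
  ∀ p, ProperPath G X Y p → PossDirAlong G p → StartsVisible vis p

/-- Forbidden nodes: possible descendants of a node `w ∉ X` lying on a proper
possibly causal path from `X` to `Y`. -/
def Forb (G : PMG V) (X Y : Finset V) : Set V :=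
  { v | ∃ w, w ∉ X ∧
      (∃ p, ProperPath G X Y p ∧ PossDirAlong G p ∧ w ∈ p) ∧
      PossDescendant G w v }

/-- Forbidden nodes in a DAG or MAG: descendants of a node `w ∉ X` lying on a
proper causal path from `X` to `Y`. -/
def ForbD (G : PMG V) (X Y : Finset V) : Set V :=
  { v | ∃ w, w ∉ X ∧
      (∃ p, ProperPath G X Y p ∧ DirectedAlong G p ∧ w ∈ p) ∧
      Descendant G w v }

/-- The generalized adjustment criterion (GAC) relative to `(X,Y)`, with
visibility predicate `vis`. -/
def GAC (G : PMG V) (vis : V → V → Prop) (X Y Z : Finset V) : Prop :=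
  Amenable G vis X Y ∧
  (∀ z ∈ Z, z ∉ Forb G X Y) ∧
  (∀ p, ProperPath G X Y p → DefStatus G p → ¬ PossDirAlong G p → ¬ MConn G Z p)

/-- The adjustment criterion (AC) for DAGs and MAGs relative to `(X,Y)`, with
visibility predicate `vis`. -/
def AC (H : PMG V) (vis : V → V → Prop) (X Y Z : Finset V) : Prop :=
  (∀ p, ProperPath H X Y p → DirectedAlong H p → StartsVisible vis p) ∧
  (∀ z ∈ Z, z ∉ ForbD H X Y) ∧
  (∀ p, ProperPath H X Y p → ¬ PossDirAlong H p → ¬ MConn H Z p)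

/-- `cls` is the Markov equivalence class of DAGs represented by the CPDAG `G`. -/
def IsCPDAGOf (G : PMG V) (cls : Set (PMG V)) : Prop :=
  cls.Nonempty ∧
  (∀ D ∈ cls, IsDAG D) ∧
  (∀ D ∈ cls, ∀ D', IsDAG D' → MarkovEquiv D D' → D' ∈ cls) ∧
  (∀ D ∈ cls, ∀ D' ∈ cls, MarkovEquiv D D') ∧
  (∀ D ∈ cls, ∀ a b, G.Adj a b ↔ D.Adj a b) ∧
  (∀ a b, G.Adj a b → (G.DirEdge a b ∨ G.NondirEdge a b)) ∧
  (∀ a b, G.DirEdge a b ↔ (G.Adj a b ∧ ∀ D ∈ cls, D.DirEdge a b))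

/-- `cls` is the Markov equivalence class of MAGs represented by the PAG `P`. -/
def IsPAGOf (P : PMG V) (cls : Set (PMG V)) : Prop :=
  cls.Nonempty ∧
  (∀ M ∈ cls, IsMAG M) ∧
  (∀ M ∈ cls, ∀ M', IsMAG M' → MarkovEquiv M M' → M' ∈ cls) ∧
  (∀ M ∈ cls, ∀ M' ∈ cls, MarkovEquiv M M') ∧
  (∀ M ∈ cls, ∀ a b, P.Adj a b ↔ M.Adj a b) ∧
  (∀ a b, P.mark a b = some Mark.arrow ↔ (P.Adj a b ∧ ∀ M ∈ cls, M.mark a b = some Mark.arrow)) ∧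
  (∀ a b, P.mark a b = some Mark.tail ↔ (P.Adj a b ∧ ∀ M ∈ cls, M.mark a b = some Mark.tail))

section Density

variable {Ω : Type} [Fintype V] [DecidableEq V] [Fintype Ω]

/-- `f` is a probability density (pmf) over the joint state space. -/
def IsDensity (f : (V → Ω) → ℝ) : Prop :=
  (∀ v, 0 ≤ f v) ∧ ∑ v, f v = 1

/-- The marginal density of the variables in `S`, evaluated at `v`. -/
noncomputable def margOn (f : (V → Ω) → ℝ) (S : Finset V) (v : V → Ω) : ℝ :=
  ∑ w : V → Ω, if ∀ i ∈ S, w i = v i then f w else 0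

/-- The conditional density of the variables in `A` given those in `B`, at `v`. -/
noncomputable def condOn (f : (V → Ω) → ℝ) (A B : Finset V) (v : V → Ω) : ℝ :=
  margOn f (A ∪ B) v / margOn f B v

/-- The parents of `i` in `G`. -/
noncomputable def parents (G : PMG V) (i : V) : Finset V :=
  Finset.univ.filter (fun j => G.DirEdge j i)

/-- `f` factorizes according to the DAG `G`. -/
def ConsistentWith (G : PMG V) (f : (V → Ω) → ℝ) : Prop :=
  ∀ v, f v = ∏ i, condOn f {i} (parents G i) v

/-- The post-intervention density `f(· | do(X = xval))` (truncated factorization). -/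
noncomputable def doDens (G : PMG V) (f : (V → Ω) → ℝ) (X : Finset V) (xval : V → Ω) :
    (V → Ω) → ℝ :=
  fun v => if ∀ i ∈ X, v i = xval i then ∏ i ∈ Xᶜ, condOn f {i} (parents G i) v else 0

/-- Overwrite `v` on `Z` by the assignment `w`. -/
noncomputable def patch (Z : Finset V) (v : V → Ω) (w : {i // i ∈ Z} → Ω) : V → Ω :=
  fun i => if h : i ∈ Z then w ⟨i, h⟩ else v i

end Density

/-- `Z` is an adjustment set relative to `(X,Y)` in the DAG `D`: for every finite state
space and every density consistent with `D`, the adjustment formula holds. -/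
def IsAdjSetDAG [Fintype V] [DecidableEq V] (D : PMG V) (X Y Z : Finset V) : Prop :=
  ∀ (Ω : Type) [Fintype Ω] [DecidableEq Ω] (f : (V → Ω) → ℝ),
    IsDensity f → ConsistentWith D f →
    ∀ v : V → Ω,
      margOn (doDens D f X v) Y v =
        if Z = ∅ then condOn f Y X v
        else ∑ w : ({i // i ∈ Z} → Ω),
          condOn f Y (X ∪ Z) (patch Z v w) * margOn f Z (patch Z v w)

/-- The marginal of a density over `V ⊕ L` on the observed variables `V`. -/
noncomputable def obsMargin {L : Type} [Fintype V] [Fintype L] [DecidableEq V] [DecidableEq L]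
    {Ω : Type} [Fintype Ω] (f : ((V ⊕ L) → Ω) → ℝ) : (V → Ω) → ℝ :=
  fun v => ∑ w : (V ⊕ L) → Ω, if ∀ i : V, w (Sum.inl i) = v i then f w else 0

/-- `M` is the MAG over the observed variables `V` of the DAG `D'` over `V ⊕ L`. -/
def IsMAGOverObs {L : Type} (D' : PMG (V ⊕ L)) (M : PMG V) : Prop :=
  (∀ a b : V, M.Adj a b ↔ (a ≠ b ∧ ∀ S : Finset V, a ∉ S → b ∉ S →
      ¬ MSep D' (Sum.inl a) (Sum.inl b) (S.image Sum.inl))) ∧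
  (∀ a b : V, M.Adj a b →
    ((M.mark a b = some Mark.arrow ↔ ¬ Descendant D' (Sum.inl b) (Sum.inl a)) ∧
     (M.mark a b = some Mark.tail ↔ Descendant D' (Sum.inl b) (Sum.inl a))))

/-- `Z` is an adjustment set relative to `(X,Y)` in the MAG `M`: for every DAG `D'`
with latent variables whose MAG over `V` is `M` and every consistent density,
the adjustment formula holds for the observed margin. -/
def IsAdjSetMAG [Fintype V] [DecidableEq V] (M : PMG V) (X Y Z : Finset V) : Prop :=
  ∀ (Ω L : Type) [Fintype Ω] [DecidableEq Ω] [Fintype L] [DecidableEq L]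
    (D' : PMG (V ⊕ L)) (f' : ((V ⊕ L) → Ω) → ℝ),
    IsDAG D' → IsMAGOverObs D' M → IsDensity f' → ConsistentWith D' f' →
    ∀ v : (V ⊕ L) → Ω,
      margOn (obsMargin (doDens D' f' (X.image Sum.inl) v)) Y (fun i => v (Sum.inl i)) =
        if Z = ∅ then condOn (obsMargin f') Y X (fun i => v (Sum.inl i))
        else ∑ w : ({i // i ∈ Z} → Ω),
          condOn (obsMargin f') Y (X ∪ Z) (patch Z (fun i => v (Sum.inl i)) w) *
            margOn (obsMargin f') Z (patch Z (fun i => v (Sum.inl i)) w)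

/-- The distance-from-`Z` of a node `q`: the length of a shortest directed path
(possibly of length 0) from `q` to a member of `Z`. -/
noncomputable def distZ (G : PMG V) (Z : Finset V) (q : V) : ℕ :=
  sInf { n | ∃ p, IsPath G p ∧ DirectedAlong G p ∧ p.head? = some q ∧
      (∃ z ∈ Z, p.getLast? = some z) ∧ p.length = n + 1 }

/-- The distance-from-`Z` of a path `p`: the sum of the distances-from-`Z`
of the colliders on `p`. -/
noncomputable def pathDistZ (G : PMG V) (Z : Finset V) (p : List V) : ℕ :=
  ∑ i ∈ Finset.range p.length,
    if ColliderAt G p i then (p[i+1]?.elim 0 (distZ G Z)) else 0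

end PMG

namespace PMG

variable {V : Type}

/-- arrowhead at `b` on the edge between `a` and `b`. -/
def Arr (G : PMG V) (a b : V) : Prop := G.mark a b = some Mark.arrow

/-- ancestor relation. -/
def Anc (G : PMG V) : V → V → Prop := Relation.ReflTransGen G.DirEdge

/-- list of the first `n+1` values of `w`. -/
def toL (w : ℕ → V) (n : ℕ) : List V := (List.range (n+1)).map w

lemma toL_length (w : ℕ → V) (n : ℕ) : (toL w n).length = n + 1 := by simp [toL]

lemma toL_get (w : ℕ → V) (n k : ℕ) (h : k ≤ n) : (toL w n)[k]? = some (w k) := by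
  have : k < n + 1 := by omega
  simp [toL, List.getElem?_range this]

lemma toL_get_some {w : ℕ → V} {n k : ℕ} {a : V} (h : (toL w n)[k]? = some a) :
    k ≤ n ∧ w k = a := by
  by_cases hk : k ≤ n
  · rw [toL_get w n k hk] at h
    exact ⟨hk, by simpa using h⟩
  · rw [List.getElem?_eq_none (by rw [toL_length]; omega)] at h
    cases h

lemma toL_head (w : ℕ → V) (n : ℕ) : (toL w n).head? = some (w 0) := by
  rw [List.head?_eq_getElem?, toL_get w n 0 (by omega)]

lemma toL_last (w : ℕ → V) (n : ℕ) : (toL w n).getLast? = some (w n) := by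
  rw [List.getLast?_eq_getElem?, toL_length, Nat.add_sub_cancel, toL_get w n n le_rfl]

lemma exists_toL (p : List V) (h : p ≠ []) : ∃ w, p = toL w (p.length - 1) := by
  have hl : 0 < p.length := List.length_pos_iff.mpr h
  refine ⟨fun k => if hk : k < p.length then p[k] else p[0], ?_⟩
  apply List.ext_getElem?
  intro k
  by_cases hk : k < p.length
  · rw [toL_get _ _ _ (by omega)]
    simp [hk]
  · rw [List.getElem?_eq_none (by omega), List.getElem?_eq_none (by rw [toL_length]; omega)]

lemma toL_mem {w : ℕ → V} {n : ℕ} {c : V} : c ∈ toL w n ↔ ∃ k, k ≤ n ∧ w k = c := by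
  simp only [toL, List.mem_map, List.mem_range, Nat.lt_succ_iff]

lemma toL_tail_mem {w : ℕ → V} {n : ℕ} {c : V} :
    c ∈ (toL w n).tail ↔ ∃ k, 1 ≤ k ∧ k ≤ n ∧ w k = c := by
  rw [List.mem_iff_getElem?]
  constructor
  · rintro ⟨k, hk⟩
    rw [List.getElem?_tail] at hk
    obtain ⟨h1, h2⟩ := toL_get_some hk
    exact ⟨k+1, by omega, h1, h2⟩
  · rintro ⟨k, h1, h2, rfl⟩
    refine ⟨k-1, ?_⟩
    rw [List.getElem?_tail, show k - 1 + 1 = k by omega, toL_get _ _ _ h2]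

lemma toL_nodup {w : ℕ → V} {n : ℕ} :
    (toL w n).Nodup ↔ ∀ i j, i < j → j ≤ n → w i ≠ w j := by
  constructor
  · intro h i j hij hj he
    have h1 := List.nodup_iff_injective_get.mp h
    have := @h1 ⟨i, by rw [toL_length]; omega⟩ ⟨j, by rw [toL_length]; omega⟩ (by
      simpa [toL] using he)
    simp at this
    omega
  · intro h
    refine List.Nodup.map_on ?_ List.nodup_range
    intro a ha b hb hab
    simp only [List.mem_range] at ha hb
    rcases lt_trichotomy a b with h' | h' | h'
    · exact absurd hab (h a b h' (by omega))
    · exact h'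
    · exact absurd hab.symm (h b a h' (by omega))

lemma toL_chain {G : PMG V} {w : ℕ → V} {n : ℕ} :
    (toL w n).Chain' G.Adj ↔ ∀ k, k < n → G.Adj (w k) (w (k+1)) := by
  rw [List.Chain', List.isChain_iff_getElem]
  constructor
  · intro h k hk
    have := h k (by rw [toL_length]; omega)
    simpa [toL] using this
  · intro h k hk
    rw [toL_length] at hk
    simpa [toL] using h k (by omega)

lemma toL_isPath {G : PMG V} {w : ℕ → V} {n : ℕ} :
    IsPath G (toL w n) ↔ (∀ i j, i < j → j ≤ n → w i ≠ w j) ∧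
      ∀ k, k < n → G.Adj (w k) (w (k+1)) := by
  unfold IsPath
  rw [toL_nodup, toL_chain]
  have : toL w n ≠ [] := by
    intro h
    have := toL_length w n
    rw [h] at this
    simp at this
  tauto

lemma toL_directed {G : PMG V} {w : ℕ → V} {n : ℕ} :
    DirectedAlong G (toL w n) ↔ ∀ k, k < n → G.DirEdge (w k) (w (k+1)) := by
  constructor
  · intro h k hk
    exact h k _ _ (toL_get _ _ _ (by omega)) (toL_get _ _ _ (by omega))
  · intro h k a b ha hb
    obtain ⟨_, rfl⟩ := toL_get_some ha
    obtain ⟨_, rfl⟩ := toL_get_some hb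
    exact h k (by omega)

lemma toL_possDir {G : PMG V} {w : ℕ → V} {n : ℕ} :
    PossDirAlong G (toL w n) ↔ ∀ k, k < n → ¬ G.Arr (w (k+1)) (w k) := by
  constructor
  · intro h k hk
    exact h k _ _ (toL_get _ _ _ (by omega)) (toL_get _ _ _ (by omega))
  · intro h k a b ha hb
    obtain ⟨_, rfl⟩ := toL_get_some ha
    obtain ⟨_, rfl⟩ := toL_get_some hb
    exact h k (by omega)

lemma toL_collider {G : PMG V} {w : ℕ → V} {n i : ℕ} :
    ColliderAt G (toL w n) i ↔ i + 2 ≤ n ∧ G.Arr (w i) (w (i+1)) ∧ G.Arr (w (i+2)) (w (i+1)) := by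
  constructor
  · rintro ⟨a, b, c, ha, hb, hc, h1, h2⟩
    obtain ⟨_, rfl⟩ := toL_get_some ha
    obtain ⟨_, rfl⟩ := toL_get_some hb
    obtain ⟨_, rfl⟩ := toL_get_some hc
    exact ⟨by omega, h1, h2⟩
  · rintro ⟨h, h1, h2⟩
    exact ⟨_, _, _, toL_get _ _ _ (by omega), toL_get _ _ _ (by omega),
      toL_get _ _ _ (by omega), h1, h2⟩

lemma Adj.sym {G : PMG V} {a b : V} (h : G.Adj a b) : G.Adj b a := (G.symm a b).1 h

lemma Arr.adj {G : PMG V} {a b : V} (h : G.Arr a b) : G.Adj a b := by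
  unfold Arr at h
  simp [Adj, h]

lemma DirEdge.arr {G : PMG V} {a b : V} (h : G.DirEdge a b) : G.Arr a b := h.1

lemma DirEdge.adj {G : PMG V} {a b : V} (h : G.DirEdge a b) : G.Adj a b := h.arr.adj

lemma DirEdge.not_arr {G : PMG V} {a b : V} (h : G.DirEdge a b) : ¬ G.Arr b a := by
  intro h'
  have := h.2
  unfold Arr at h'
  rw [h'] at this
  simp at this

lemma DirEdge.anc {G : PMG V} {a b : V} (h : G.DirEdge a b) : G.Anc a b :=
  Relation.ReflTransGen.single h

lemma Adj.ne {G : PMG V} {a b : V} (h : G.Adj a b) : a ≠ b := by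
  rintro rfl
  simp [Adj, G.irrefl] at h

/-- Ancestors give directed paths. -/
lemma anc_iff_desc {G : PMG V} {a b : V} : G.Anc a b ↔ Descendant G a b := by
  constructor
  · intro h
    induction h using Relation.ReflTransGen.head_induction_on with
    | refl =>
      refine ⟨toL (fun _ => b) 0, ?_, ?_, toL_head _ _, toL_last _ _⟩
      · rw [toL_isPath]; constructor <;> intros <;> omega
      · rw [toL_directed]; intros; omega
    | @head a c hac hcb ih =>
      obtain ⟨q, hq, hd, hh, hl⟩ := ih
      obtain ⟨w, hw⟩ := exists_toL q hq.1
      generalize q.length - 1 = n at hw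
      subst hw
      rw [toL_isPath] at hq
      rw [toL_directed] at hd
      rw [toL_head] at hh
      rw [toL_last] at hl
      simp only [Option.some.injEq] at hh hl
      by_cases hm : ∃ k, k ≤ n ∧ w k = a
      · obtain ⟨k, hk, hka⟩ := hm
        refine ⟨toL (fun m => w (k+m)) (n-k), ?_, ?_, ?_, ?_⟩
        · rw [toL_isPath]
          exact ⟨fun i j hij hj => hq.1 _ _ (by omega) (by omega),
            fun m hm => hq.2 (k+m) (by omega)⟩
        · rw [toL_directed]
          exact fun m hm => hd (k+m) (by omega)
        · rw [toL_head]; simp [hka]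
        · rw [toL_last]; simp [show k + (n-k) = n by omega, hl]
      · push Not at hm
        have hD : ∀ k, k < n+1 → G.DirEdge ((fun m => if m = 0 then a else w (m-1)) k)
            ((fun m => if m = 0 then a else w (m-1)) (k+1)) := by
          intro k hk
          rcases Nat.eq_zero_or_pos k with rfl | h0
          · simpa [hh] using hac
          · have := hd (k-1) (by omega)
            rw [show k - 1 + 1 = k by omega] at this
            simpa [show k ≠ 0 by omega] using this
        refine ⟨toL (fun m => if m = 0 then a else w (m-1)) (n+1), ?_, ?_, ?_, ?_⟩
        · rw [toL_isPath]
          refine ⟨fun i j hij hj => ?_, fun k hk => (hD k hk).adj⟩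
          rcases Nat.eq_zero_or_pos i with rfl | h0
          · simpa [show j ≠ 0 by omega] using (hm (j-1) (by omega)).symm
          · simpa [show j ≠ 0 by omega, show i ≠ 0 by omega] using
              hq.1 (i-1) (j-1) (by omega) (by omega)
        · rw [toL_directed]; exact hD
        · rw [toL_head]; simp
        · rw [toL_last]; simp [hl]
  · rintro ⟨q, hq, hd, hh, hl⟩
    obtain ⟨w, hw⟩ := exists_toL q hq.1
    generalize q.length - 1 = n at hw
    subst hw
    rw [toL_directed] at hd
    rw [toL_head] at hh
    rw [toL_last] at hl
    simp only [Option.some.injEq] at hh hl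
    subst hh hl
    have : ∀ k, k ≤ n → G.Anc (w 0) (w k) := by
      intro k
      induction k with
      | zero => intro _; exact Relation.ReflTransGen.refl
      | succ k ih => intro hk; exact (ih (by omega)).tail (hd k (by omega))
    exact this n le_rfl

lemma dir_of_not_arr {G : PMG V} (hG : IsAncestral G) {a b : V} (h : G.Adj a b) (h' : ¬ G.Arr a b) : G.DirEdge b a := by
  rcases hG.1 a b h with h1 | h1 | h1
  · exact absurd h1.1 h'
  · exact h1
  · exact absurd h1.1 h'

lemma arr_not_anc {G : PMG V} (hG : IsAncestral G) {a b : V} (h : G.Arr a b) : ¬ G.Anc b a := by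
  intro hba
  rcases hG.1 a b h.adj with h1 | h1 | h1
  · exact h.adj.ne (hG.2.1 a b (anc_iff_desc.1 h1.anc) (anc_iff_desc.1 hba))
  · exact h1.not_arr h
  · exact hG.2.2 b a (anc_iff_desc.1 hba) h1

lemma arr_of_not_anc {G : PMG V} (hG : IsAncestral G) {a b : V} (h : G.Adj a b) (h' : ¬ G.Anc b a) : G.Arr a b := by
  by_contra h1
  exact h' (dir_of_not_arr hG h h1).anc

lemma arr_trans {G : PMG V} (hG : IsAncestral G) {a b c : V} (h1 : G.Arr a b) (h2 : G.Anc b c) (h : G.Adj a c) : G.Arr a c := by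
  by_contra h3
  exact arr_not_anc hG h1 (h2.trans (dir_of_not_arr hG h h3).anc)

lemma dir_of_anc {G : PMG V} (hG : IsAncestral G) {a c : V} (h2 : G.Anc a c) (h : G.Adj a c) : G.DirEdge a c := by
  apply dir_of_not_arr hG h.sym
  intro h3
  exact arr_not_anc hG h3 h2

/-- `v` is an ancestor of a member of `T`. -/
def AncS (G : PMG V) (T : Finset V) (v : V) : Prop := ∃ z ∈ T, G.Anc v z

/-- triple condition for m-connection. -/
def OK (G : PMG V) (T : Finset V) (u v w : V) : Prop :=
  (G.Arr u v → G.Arr w v → G.AncS T v) ∧ (¬ (G.Arr u v ∧ G.Arr w v) → v ∉ T)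

lemma OK.sym {G : PMG V} {T : Finset V} {u v w : V} (h : OK G T u v w) : OK G T w v u :=
  ⟨fun a b => h.1 b a, fun a => h.2 (fun b => a b.symm)⟩

lemma mconn_iff {G : PMG V} (hG : IsAncestral G) {T : Finset V} {w : ℕ → V} {n : ℕ}
    (hadj : ∀ k, k < n → G.Adj (w k) (w (k+1))) :
    MConn G T (toL w n) ↔ ∀ k, k + 2 ≤ n → OK G T (w k) (w (k+1)) (w (k+2)) := by
  have key : ∀ k, k + 2 ≤ n → (DefNonColliderAt G (toL w n) k ↔
      ¬ (G.Arr (w k) (w (k+1)) ∧ G.Arr (w (k+2)) (w (k+1)))) := by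
    intro k hk
    constructor
    · rintro ⟨a, b, c, ha, hb, hc, h⟩ ⟨h1, h2⟩
      obtain ⟨_, rfl⟩ := toL_get_some ha
      obtain ⟨_, rfl⟩ := toL_get_some hb
      obtain ⟨_, rfl⟩ := toL_get_some hc
      unfold Arr at h1 h2
      rw [h1, h2] at h
      simp at h
    · intro h
      refine ⟨_, _, _, toL_get _ _ _ (by omega), toL_get _ _ _ (by omega),
        toL_get _ _ _ (by omega), ?_⟩
      by_cases h1 : G.Arr (w k) (w (k+1))
      · right; left
        exact (dir_of_not_arr hG (hadj (k+1) (by omega)).sym (fun h2 => h ⟨h1, h2⟩)).2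
      · left
        exact (dir_of_not_arr hG (hadj k (by omega)) h1).2
  constructor
  · rintro ⟨_, h2, h3⟩ k hk
    constructor
    · intro a b
      obtain ⟨z, hz, hd⟩ := h3 k (w (k+1)) (toL_get _ _ _ (by omega)) (toL_collider.2 ⟨hk, a, b⟩)
      exact ⟨z, hz, anc_iff_desc.2 hd⟩
    · intro a
      exact h2 k (w (k+1)) (toL_get _ _ _ (by omega)) ((key k hk).2 a)
  · intro h
    refine ⟨?_, ?_, ?_⟩
    · intro i hi
      rw [toL_length] at hi
      rw [toL_collider, key i (by omega)]
      have : i + 2 ≤ n := by omega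
      tauto
    · intro i b hb hn
      have hi : i + 2 ≤ n := by
        obtain ⟨a, b, c, ha, hb, hc, h⟩ := hn
        exact (toL_get_some hc).1
      obtain ⟨_, rfl⟩ := toL_get_some hb
      exact (h i hi).2 ((key i hi).1 hn)
    · intro i b hb hc
      obtain ⟨_, rfl⟩ := toL_get_some hb
      rw [toL_collider] at hc
      obtain ⟨z, hz, hd⟩ := (h i hc.1).1 hc.2.1 hc.2.2
      exact ⟨z, hz, anc_iff_desc.1 hd⟩

/-- an m-connecting walk given `T`. -/
def Walk (G : PMG V) (T : Finset V) (w : ℕ → V) (n : ℕ) : Prop :=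
  (∀ k, k < n → G.Adj (w k) (w (k+1))) ∧ ∀ k, k + 2 ≤ n → OK G T (w k) (w (k+1)) (w (k+2))

lemma Walk.rev {G : PMG V} {T : Finset V} {w : ℕ → V} {n : ℕ} (h : Walk G T w n) :
    Walk G T (fun k => w (n - k)) n := by
  constructor
  · intro k hk
    have := h.1 (n-(k+1)) (by omega)
    rw [show n - (k+1) + 1 = n - k by omega] at this
    exact this.sym
  · intro k hk
    have := h.2 (n-(k+2)) (by omega)
    rw [show n - (k+2) + 1 = n - (k+1) by omega, show n - (k+2) + 2 = n - k by omega] at this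
    exact this.sym

lemma Walk.fwd {G : PMG V} (hG : IsAncestral G) {T : Finset V} {w : ℕ → V} {n : ℕ}
    (h : Walk G T w n) {j : ℕ} (hj : j ≤ n) :
    ∀ t m, m + t + 1 = j → G.DirEdge (w m) (w (m+1)) →
      G.AncS T (w m) ∨ G.Anc (w (m+1)) (w j) := by
  intro t
  induction t with
  | zero => intro m hm _; right; rw [← hm]; exact Relation.ReflTransGen.refl
  | succ t ih =>
    intro m hm hd
    have hok := h.2 m (by omega)
    by_cases h1 : G.Arr (w (m+2)) (w (m+1))
    · obtain ⟨z, hz, hz'⟩ := hok.1 hd.arr h1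
      exact Or.inl ⟨z, hz, hd.anc.trans hz'⟩
    · have h2 := dir_of_not_arr hG (h.1 (m+1) (by omega)).sym h1
      rcases ih (m+1) (by omega) h2 with ⟨z, hz, hz'⟩ | h3
      · exact Or.inl ⟨z, hz, hd.anc.trans hz'⟩
      · exact Or.inr (h2.anc.trans h3)

/-- m-connecting walks give m-connecting paths. -/
lemma Walk.not_msep {G : PMG V} (hG : IsAncestral G) {T : Finset V} {w : ℕ → V} {n : ℕ}
    (h : Walk G T w n) (hne : w 0 ≠ w n) : ¬ MSep G (w 0) (w n) T := by
  have hex : ∃ m, ∃ w', Walk G T w' m ∧ w' 0 = w 0 ∧ w' m = w n := ⟨n, w, h, rfl, rfl⟩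
  obtain ⟨w', hw, h0, hn⟩ := Nat.find_spec hex
  have hmin := fun m (hm : m < Nat.find hex) => Nat.find_min hex hm
  generalize Nat.find hex = m at *
  have hinj : ∀ i j, i < j → j ≤ m → w' i ≠ w' j := by
    intro i j hij hj he
    apply hmin (m-(j-i)) (by omega)
    refine ⟨fun k => if k ≤ i then w' k else w' (k + (j-i)), ⟨?_, ?_⟩, by simp [h0], ?_⟩
    · intro k hk
      rcases lt_trichotomy k i with hki | rfl | hki
      · simpa [show k ≤ i by omega, show k+1 ≤ i by omega] using hw.1 k (by omega)
      · have := hw.1 j (by omega)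
        rw [← he] at this
        simpa [show k+1+(j-k) = j+1 by omega] using this
      · simpa [show ¬ k ≤ i by omega, show ¬ k+1 ≤ i by omega,
          show k + 1 + (j-i) = k + (j-i) + 1 by omega] using hw.1 (k+(j-i)) (by omega)
    · intro k hk
      rcases lt_trichotomy (k+1) i with hki | hki | hki
      · simpa [show k ≤ i by omega, show k+1 ≤ i by omega, show k+2 ≤ i by omega]
          using hw.2 k (by omega)
      · subst hki
        have e : k + 2 + (j-(k+1)) = j+1 := by omega
        simp only [show k ≤ k+1 by omega, show ¬ k+2 ≤ k+1 by omega, if_true, le_refl, if_false, e]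
        have o1 := hw.2 k (by omega)
        have o2 := hw.2 (j-1) (by omega)
        rw [show j - 1 + 1 = j by omega, show j - 1 + 2 = j + 1 by omega] at o2
        constructor
        · intro a b
          by_cases c : G.Arr (w' (k+2)) (w' (k+1))
          · exact o1.1 a c
          · have d := dir_of_not_arr hG (hw.1 (k+1) (by omega)).sym c
            rcases hw.fwd hG hj (j-(k+1)-1) (k+1) (by omega) d with h3 | h3
            · exact h3
            · rw [← he] at h3
              exact absurd h3 (arr_not_anc hG d.arr)
        · intro a hT
          by_cases c : G.Arr (w' k) (w' (k+1))
          · have : ¬ G.Arr (w' (j+1)) (w' j) := by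
              intro c'; rw [← he] at c'; exact a ⟨c, c'⟩
            rw [he] at hT
            exact o2.2 (fun x => this x.2) hT
          · exact o1.2 (fun x => c x.1) hT
      · rcases Nat.lt_or_ge i k with hki' | hki'
        · simpa [show ¬ k ≤ i by omega, show ¬ k+1 ≤ i by omega, show ¬ k+2 ≤ i by omega,
            show k + 1 + (j-i) = k + (j-i) + 1 by omega,
            show k + 2 + (j-i) = k + (j-i) + 2 by omega] using hw.2 (k+(j-i)) (by omega)
        · have : k = i := by omega
          subst this
          have := hw.2 j (by omega)
          rw [← he] at this
          simpa [show k+1+(j-k) = j+1 by omega, show k+2+(j-k) = j+2 by omega] using this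
    · rw [← hn]
      by_cases hh : m - (j-i) ≤ i
      · have e : j = m := by omega
        have e2 : m - (j-i) = i := by omega
        simp only [e2, le_refl, if_true]
        rw [he, e]
      · simp [hh, show m - (j-i) + (j-i) = m by omega]
  intro hsep
  have hm0 : m ≠ 0 := by
    rintro rfl
    rw [← h0, ← hn] at hne
    exact hne rfl
  refine hsep (toL w' m) ⟨toL_isPath.2 ⟨hinj, hw.1⟩, by rw [toL_head, h0], by rw [toL_last, hn],
    by rw [toL_length]; omega⟩ ((mconn_iff hG hw.1).2 hw.2)

/-- Reachability by m-connecting walks; `u - v` is the last edge. -/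
inductive Reach (G : PMG V) (T : Finset V) (a : V) : V → V → Prop
  | base {v : V} : G.Adj a v → Reach G T a a v
  | step {u v w : V} : Reach G T a u v → G.Adj v w → OK G T u v w → Reach G T a v w

lemma Reach.walk {G : PMG V} {T : Finset V} {a u v : V} (h : Reach G T a u v) :
    ∃ w n, Walk G T w (n+1) ∧ w 0 = a ∧ w n = u ∧ w (n+1) = v := by
  induction h with
  | @base v hv =>
    refine ⟨fun k => if k = 0 then a else v, 0, ⟨?_, ?_⟩, by simp, by simp, by simp⟩
    · intro k hk
      have : k = 0 := by omega
      subst this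
      simpa using hv
    · intro k hk; omega
  | @step u v x hr hadj hok ih =>
    obtain ⟨w, n, hw, h0, hn, hn1⟩ := ih
    refine ⟨fun k => if k ≤ n+1 then w k else x, n+1, ⟨?_, ?_⟩, by simp [h0], by simp [hn1], by simp⟩
    · intro k hk
      by_cases h1 : k ≤ n
      · simpa [h1, show k ≤ n+1 by omega] using hw.1 k (by omega)
      · have : k = n+1 := by omega
        subst this
        simpa [hn1] using hadj
    · intro k hk
      by_cases h1 : k + 1 ≤ n
      · simpa [h1, show k ≤ n by omega, show k ≤ n+1 by omega] using hw.2 k (by omega)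
      · have : k = n := by omega
        subst this
        simpa [hn1, hn] using hok

lemma Reach.not_msep {G : PMG V} (hG : IsAncestral G) {T : Finset V} {a u b : V}
    (h : Reach G T a u b) (hne : a ≠ b) : ¬ MSep G a b T := by
  obtain ⟨w, n, hw, h0, hn, hn1⟩ := h.walk
  subst h0 hn1
  exact hw.not_msep hG hne

/-- from an arrival at `v` not ancestor of `T`, continue by a directed path. -/
lemma Reach.dirpath {G : PMG V} (hG : IsAncestral G) {T : Finset V} {a b v : V}
    (h : G.Anc v b) : ∀ u, Reach G T a u v → ¬ G.AncS T v → v ≠ b → ∃ u', Reach G T a u' b := by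
  induction h using Relation.ReflTransGen.head_induction_on with
  | refl => intro u _ _ h; exact absurd rfl h
  | @head v c hvc hcb ih =>
    intro u hr hn hne
    have h1 : Reach G T a v c := by
      refine hr.step hvc.adj ⟨fun _ h => absurd h hvc.not_arr, fun _ hT => hn ⟨v, hT, .refl⟩⟩
    by_cases hc : c = b
    · subst hc; exact ⟨_, h1⟩
    · exact ih v h1 (fun ⟨z, hz, hz'⟩ => hn ⟨z, hz, hvc.anc.trans hz'⟩) hc

/-- going backwards along a directed path from `v` to `a`. -/
lemma Reach.backpath {G : PMG V} (hG : IsAncestral G) {T : Finset V} {a v : V}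
    (h : G.Anc v a) : ¬ G.AncS T v → v ≠ a → ∃ u, Reach G T a u v ∧ ¬ G.Arr u v := by
  induction h using Relation.ReflTransGen.head_induction_on with
  | refl => intro _ h; exact absurd rfl h
  | @head v c hvc hcb ih =>
    intro hn hne
    by_cases hc : c = a
    · subst hc; exact ⟨_, Reach.base hvc.adj.sym, hvc.not_arr⟩
    · have hnc : ¬ G.AncS T c := fun ⟨z, hz, hz'⟩ => hn ⟨z, hz, hvc.anc.trans hz'⟩
      obtain ⟨u, hu, hu'⟩ := ih hnc hc
      exact ⟨c, hu.step hvc.adj.sym ⟨fun h => absurd h hu', fun _ hT => hnc ⟨c, hT, .refl⟩⟩,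
        hvc.not_arr⟩

/-- In a MAG, non-adjacent nodes are separated by their ancestors. -/
lemma anc_sep [Fintype V] {G : PMG V} (hM : IsMAG G) {a b : V} (hne : a ≠ b) (hna : ¬ G.Adj a b)
    (T : Finset V) (hT : ∀ v, v ∈ T ↔ (G.Anc v a ∨ G.Anc v b) ∧ v ≠ a ∧ v ≠ b) :
    MSep G a b T := by
  have hG := hM.1
  obtain ⟨T', ha', hb', hsep⟩ := hM.2 a b hne hna
  intro p hp hc
  obtain ⟨hpath, hh, hl, hlen⟩ := hp
  obtain ⟨w, hw⟩ := exists_toL p hpath.1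
  generalize p.length - 1 = n at hw
  subst hw
  rw [toL_isPath] at hpath
  rw [toL_head] at hh
  rw [toL_last] at hl
  rw [toL_length] at hlen
  simp only [Option.some.injEq] at hh hl
  rw [mconn_iff hG hpath.2] at hc
  have hW : Walk G T w n := ⟨hpath.2, hc⟩
  have hAS : ∀ v, G.AncS T v → G.Anc v a ∨ G.Anc v b := by
    rintro v ⟨z, hz, hvz⟩
    rcases ((hT z).1 hz).1 with h | h
    · exact Or.inl (hvz.trans h)
    · exact Or.inr (hvz.trans h)
  have hcol : ∀ k, k + 2 ≤ n → (G.Arr (w k) (w (k+1)) ∧ G.Arr (w (k+2)) (w (k+1))) ∧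
      (G.Anc (w (k+1)) a ∨ G.Anc (w (k+1)) b) := by
    intro k hk
    have hA : G.Anc (w (k+1)) a ∨ G.Anc (w (k+1)) b := by
      by_cases h1 : G.Arr (w k) (w (k+1))
      · by_cases h2 : G.Arr (w (k+2)) (w (k+1))
        · exact hAS _ ((hc k hk).1 h1 h2)
        · have d := dir_of_not_arr hG (hpath.2 (k+1) (by omega)).sym h2
          rcases hW.fwd hG le_rfl (n-(k+1)-1) (k+1) (by omega) d with h3 | h3
          · exact hAS _ h3
          · rw [hl] at h3; exact Or.inr (d.anc.trans h3)
      · have d := dir_of_not_arr hG (hpath.2 k (by omega)) h1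
        have e1 : n - (n-(k+1)) = k+1 := by omega
        have e2 : n - (n-(k+1)+1) = k := by omega
        rcases hW.rev.fwd hG le_rfl (n-(n-(k+1))-1) (n-(k+1)) (by omega) (by
          simpa only [e1, e2] using d) with h3 | h3
        · simp only [e1] at h3
          exact hAS _ h3
        · simp only [e2, Nat.sub_self, hh] at h3; exact Or.inl (d.anc.trans h3)
    refine ⟨?_, hA⟩
    by_contra hno
    refine (hc k hk).2 hno ((hT _).2 ⟨hA, ?_, ?_⟩)
    · rw [← hh]; exact (hpath.1 0 (k+1) (by omega) (by omega)).symm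
    · rw [← hl]; exact hpath.1 (k+1) n (by omega) (by omega)
  have hreach : ∀ k, k + 1 ≤ n → Reach G T' a (w k) (w (k+1)) ∨ ∃ u, Reach G T' a u b := by
    intro k
    induction k with
    | zero => intro h; left; rw [hh]; apply Reach.base; rw [← hh]; exact hpath.2 0 (by omega)
    | succ k ih =>
      intro hk
      rcases ih (by omega) with h | h
      · obtain ⟨⟨c1, c2⟩, hA⟩ := hcol k (by omega)
        have hadj := hpath.2 (k+1) (by omega)
        by_cases hin : G.AncS T' (w (k+1))
        · left
          exact h.step hadj ⟨fun _ _ => hin, fun hno => absurd ⟨c1, c2⟩ hno⟩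
        · have na : w (k+1) ≠ a := by
            rw [← hh]; exact (hpath.1 0 (k+1) (by omega) (by omega)).symm
          have nb : w (k+1) ≠ b := by
            rw [← hl]; exact hpath.1 (k+1) n (by omega) (by omega)
          rcases hA with hA | hA
          · left
            obtain ⟨u, hu, hu'⟩ := Reach.backpath hG hA hin na
            exact hu.step hadj ⟨fun h => absurd h hu', fun _ hT => hin ⟨_, hT, .refl⟩⟩
          · right
            exact Reach.dirpath hG hA _ h hin nb
      · exact Or.inr h
  have : ∃ u, Reach G T' a u b := by
    rcases hreach (n-1) (by omega) with h | h
    · rw [show n - 1 + 1 = n by omega, hl] at h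
      exact ⟨_, h⟩
    · exact h
  obtain ⟨u, hu⟩ := this
  exact hu.not_msep hG hne hsep

end PMG

namespace PMG

variable {V : Type}

/-- a collider run from `w 0` to `w N` whose interior nodes are parents of `S`, with
`w 0` not adjacent to `S` (a discriminating path for `w N`, possibly a walk). -/
structure Run (G : PMG V) (w : ℕ → V) (N : ℕ) (S : V) : Prop where
  pos : 1 ≤ N
  ne : w 0 ≠ S
  nadj : ¬ G.Adj (w 0) S
  right : ∀ k, k + 1 ≤ N → G.Arr (w k) (w (k+1))
  left : ∀ k, k + 2 ≤ N → G.Arr (w (k+2)) (w (k+1))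
  par : ∀ k, k + 2 ≤ N → G.DirEdge (w (k+1)) S

lemma run_reach {G : PMG V} {T : Finset V} {w : ℕ → V} {N : ℕ}
    (right : ∀ k, k + 1 ≤ N → G.Arr (w k) (w (k+1)))
    (left : ∀ k, k + 2 ≤ N → G.Arr (w (k+2)) (w (k+1))) :
    ∀ k, k + 1 ≤ N → (∀ m, m < k → w (m+1) ∈ T) → Reach G T (w 0) (w k) (w (k+1)) := by
  intro k
  induction k with
  | zero => intro h _; exact Reach.base (right 0 h).adj
  | succ k ih =>
    intro h hT
    refine (ih (by omega) (fun m hm => hT m (by omega))).step (right (k+1) h).adj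
      ⟨fun _ _ => ⟨_, hT k (by omega), .refl⟩, fun hno => ?_⟩
    exact absurd ⟨right k (by omega), left k (by omega)⟩ hno

lemma run_mem {G : PMG V} (hG : IsAncestral G) {T : Finset V} {w : ℕ → V} {N : ℕ} {S : V}
    (hr : Run G w N S) (hsep : MSep G (w 0) S T) :
    ∀ k, k + 1 ≤ N → G.DirEdge (w (k+1)) S → w (k+1) ∈ T := by
  intro k
  induction k using Nat.strong_induction_on with
  | _ k ih =>
    intro hk hd
    by_contra hT
    have h1 := run_reach (T := T) hr.right hr.left k hk
      (fun m hm => ih m hm (by omega) (hr.par m (by omega)))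
    have h2 := h1.step hd.adj ⟨fun _ h => absurd h hd.not_arr, fun _ => hT⟩
    exact h2.not_msep hG hr.ne hsep

/-- Non-colliders on discriminating paths. -/
lemma run_noncollider {G G' : PMG V} (hM : IsMAG G) (hM' : IsMAG G') (heq : MarkovEquiv G G')
    (hadj : ∀ a b, G.Adj a b ↔ G'.Adj a b) {w : ℕ → V} {N : ℕ} {S : V}
    (hr : Run G w N S) (hd : G.DirEdge (w N) S)
    (right : ∀ k, k + 1 ≤ N → G'.Arr (w k) (w (k+1)))
    (left : ∀ k, k + 2 ≤ N → G'.Arr (w (k+2)) (w (k+1))) : G'.DirEdge (w N) S := by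
  obtain ⟨T, ha, hb, hsep⟩ := hM.2 _ _ hr.ne hr.nadj
  have hsep' := (heq _ _ T hr.ne ha hb).1 hsep
  have hpos := hr.pos
  have hA : G'.Adj (w N) S := (hadj _ _).1 hd.adj
  apply dir_of_not_arr hM'.1 hA.sym
  intro hS
  have hmem : ∀ k, k + 1 ≤ N → w (k+1) ∈ T := by
    intro k hk
    refine run_mem hM.1 hr hsep k hk ?_
    by_cases h : k + 2 ≤ N
    · exact hr.par k h
    · rw [show k + 1 = N by omega]; exact hd
  have h1 := run_reach (T := T) right left (N-1) (by omega) (fun m hm => hmem m (by omega))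
  have h3 := right (N-1) (by omega)
  have hN := hmem (N-1) (by omega)
  rw [show N - 1 + 1 = N by omega] at h1 h3 hN
  have h2 := h1.step hA ⟨fun _ _ => ⟨_, hN, .refl⟩, fun hno => absurd ⟨h3, hS⟩ hno⟩
  exact h2.not_msep hM'.1 hr.ne hsep'

/-- Colliders on discriminating paths. -/
lemma run_collider [Fintype V] {G G' : PMG V} (hM : IsMAG G) (hM' : IsMAG G')
    (heq : MarkovEquiv G G')
    (hadj : ∀ a b, G.Adj a b ↔ G'.Adj a b) {w : ℕ → V} {N : ℕ} {S : V}
    (hr : Run G w N S) (hS : G.Arr S (w N)) :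
    G'.Arr (w (N-1)) (w N) ∧ G'.Arr S (w N) := by
  classical
  have hna' : ¬ G'.Adj (w 0) S := fun h => hr.nadj ((hadj _ _).2 h)
  have hpos := hr.pos
  let T : Finset V := Finset.univ.filter
    (fun v => (G'.Anc v (w 0) ∨ G'.Anc v S) ∧ v ≠ w 0 ∧ v ≠ S)
  have hT : ∀ v, v ∈ T ↔ (G'.Anc v (w 0) ∨ G'.Anc v S) ∧ v ≠ w 0 ∧ v ≠ S := by
    intro v; simp [T]
  have hsep' := anc_sep hM' hr.ne hna' T hT
  have hsep := (heq _ _ T hr.ne (by simp [T]) (by simp [T])).2 hsep'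
  have hmem : ∀ k, k + 2 ≤ N → w (k+1) ∈ T :=
    fun k hk => run_mem hM.1 hr hsep k (by omega) (hr.par k hk)
  have h1 := run_reach (T := T) hr.right hr.left (N-1) (by omega) (fun m hm => hmem m (by omega))
  have h3 := hr.right (N-1) (by omega)
  rw [show N - 1 + 1 = N by omega] at h1 h3
  have hN : w N ∉ T := by
    intro hN
    have h2 := h1.step hS.adj.sym ⟨fun _ _ => ⟨_, hN, .refl⟩, fun hno => absurd ⟨h3, hS⟩ hno⟩
    exact h2.not_msep hM.1 hr.ne hsep
  have hN0 : w N ≠ w 0 := by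
    intro h; apply hr.nadj; rw [← h]; exact hS.adj.sym
  have hNA : ¬ (G'.Anc (w N) (w 0) ∨ G'.Anc (w N) S) :=
    fun h => hN ((hT _).2 ⟨h, hN0, hS.adj.sym.ne⟩)
  constructor
  · apply arr_of_not_anc hM'.1 ((hadj _ _).1 h3.adj)
    intro h
    by_cases h4 : N = 1
    · subst h4; exact hNA (Or.inl h)
    · have := hmem (N-2) (by omega)
      rw [show N - 2 + 1 = N - 1 by omega, hT] at this
      rcases this.1 with h5 | h5
      · exact hNA (Or.inl (h.trans h5))
      · exact hNA (Or.inr (h.trans h5))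
  · apply arr_of_not_anc hM'.1 ((hadj _ _).1 hS.adj)
    exact fun h => hNA (Or.inr h)

end PMG

namespace PMG

variable {V : Type}

/-- `q 0, …, q m` is a proper non-causal m-connecting path. -/
def Good (M : PMG V) (X Y Z : Finset V) (q : ℕ → V) (m : ℕ) : Prop :=
  (∀ i j, i < j → j ≤ m → q i ≠ q j) ∧ (∀ k, k < m → M.Adj (q k) (q (k+1))) ∧
  q 0 ∈ X ∧ q m ∈ Y ∧ (∀ k, 1 ≤ k → k ≤ m → q k ∉ X) ∧
  (∀ k, k + 2 ≤ m → OK M Z (q k) (q (k+1)) (q (k+2))) ∧ ∃ k, k < m ∧ M.Arr (q (k+1)) (q k)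

lemma toL_proper {G : PMG V} {X Y : Finset V} {q : ℕ → V} {m : ℕ} :
    ProperPath G X Y (toL q m) ↔ (∀ i j, i < j → j ≤ m → q i ≠ q j) ∧
      (∀ k, k < m → G.Adj (q k) (q (k+1))) ∧ q 0 ∈ X ∧ q m ∈ Y ∧
      (∀ k, 1 ≤ k → k ≤ m → q k ∉ X) := by
  unfold ProperPath
  rw [toL_isPath, toL_head, toL_last]
  constructor
  · rintro ⟨⟨h1, h2⟩, ⟨a, ha, ha'⟩, ⟨b, hb, hb'⟩, h3⟩
    simp only [Option.some.injEq] at ha' hb'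
    subst ha' hb'
    exact ⟨h1, h2, ha, hb, fun k hk hk' => h3 _ (toL_tail_mem.2 ⟨k, hk, hk', rfl⟩)⟩
  · rintro ⟨h1, h2, h3, h4, h5⟩
    refine ⟨⟨h1, h2⟩, ⟨_, h3, rfl⟩, ⟨_, h4, rfl⟩, ?_⟩
    intro c hc
    obtain ⟨k, hk, hk', rfl⟩ := toL_tail_mem.1 hc
    exact h5 k hk hk'

lemma good_iff {M : PMG V} (hM : IsAncestral M) {X Y Z : Finset V} {q : ℕ → V} {m : ℕ} :
    Good M X Y Z q m ↔ ProperPath M X Y (toL q m) ∧ ¬ PossDirAlong M (toL q m) ∧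
      MConn M Z (toL q m) := by
  rw [toL_proper, toL_possDir]
  constructor
  · rintro ⟨h1, h2, h3, h4, h5, h6, k, hk, hk'⟩
    exact ⟨⟨h1, h2, h3, h4, h5⟩, fun h => h k hk hk', (mconn_iff hM h2).2 h6⟩
  · rintro ⟨⟨h1, h2, h3, h4, h5⟩, h6, h7⟩
    push Not at h6
    exact ⟨h1, h2, h3, h4, h5, (mconn_iff hM h2).1 h7, h6⟩

/-- distance-from-`Z` for paths given by functions. -/
noncomputable def dsum (M : PMG V) (Z : Finset V) (q : ℕ → V) (m : ℕ) : ℕ :=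
  ∑ i ∈ Finset.range (m+1),
    if i + 2 ≤ m ∧ M.Arr (q i) (q (i+1)) ∧ M.Arr (q (i+2)) (q (i+1)) then
      distZ M Z (q (i+1)) else 0

lemma pathDist_eq (M : PMG V) (Z : Finset V) (q : ℕ → V) (m : ℕ) :
    pathDistZ M Z (toL q m) = dsum M Z q m := by
  unfold pathDistZ dsum
  rw [toL_length]
  apply Finset.sum_congr rfl
  intro i hi
  simp only [toL_collider]
  split_ifs with h
  · rw [toL_get _ _ _ (by omega)]; rfl
  · rfl

/-- The standing assumptions. -/
structure Setup (P M : PMG V) (cls : Set (PMG V)) (X Y Z : Finset V) (p : ℕ → V) (n : ℕ) :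
    Prop where
  hP : IsPAGOf P cls
  hM : M ∈ cls
  hAm : Amenable P (Visible P) X Y
  hZ : ∀ z ∈ Z, z ∉ Forb P X Y
  good : Good M X Y Z p n
  short : ∀ q m, Good M X Y Z q m → n ≤ m
  dist : ∀ q, Good M X Y Z q n → dsum M Z p n ≤ dsum M Z q n

namespace Setup

variable {P M : PMG V} {cls : Set (PMG V)} {X Y Z : Finset V} {p : ℕ → V} {n : ℕ}

lemma mag (s : Setup P M cls X Y Z p n) : IsMAG M := s.hP.2.1 M s.hM
lemma anc (s : Setup P M cls X Y Z p n) : IsAncestral M := s.mag.1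
lemma inj (s : Setup P M cls X Y Z p n) : ∀ i j, i < j → j ≤ n → p i ≠ p j := s.good.1
lemma adj (s : Setup P M cls X Y Z p n) : ∀ k, k < n → M.Adj (p k) (p (k+1)) := s.good.2.1
lemma ok (s : Setup P M cls X Y Z p n) :
    ∀ k, k + 2 ≤ n → OK M Z (p k) (p (k+1)) (p (k+2)) := s.good.2.2.2.2.2.1
lemma ok' (s : Setup P M cls X Y Z p n) (k : ℕ) (h1 : 1 ≤ k) (h2 : k + 1 ≤ n) :
    OK M Z (p (k-1)) (p k) (p (k+1)) := by
  have := s.ok (k-1) (by omega)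
  rwa [show k - 1 + 1 = k by omega, show k - 1 + 2 = k + 1 by omega] at this
lemma notX (s : Setup P M cls X Y Z p n) : ∀ k, 1 ≤ k → k ≤ n → p k ∉ X := s.good.2.2.2.2.1
lemma inj' (s : Setup P M cls X Y Z p n) {i j : ℕ} (h : i ≠ j) (hi : i ≤ n) (hj : j ≤ n) :
    p i ≠ p j := by
  rcases Nat.lt_or_gt_of_ne h with h | h
  · exact s.inj i j h hj
  · exact (s.inj j i h hi).symm

lemma padj (s : Setup P M cls X Y Z p n) {a b : V} : P.Adj a b ↔ M.Adj a b :=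
  s.hP.2.2.2.2.1 M s.hM a b
lemma parr (s : Setup P M cls X Y Z p n) {a b : V} (h : P.Arr a b) {M' : PMG V}
    (h' : M' ∈ cls) : M'.Arr a b := ((s.hP.2.2.2.2.2.1 a b).1 h).2 M' h'
lemma pdir (s : Setup P M cls X Y Z p n) {a b : V} (h : P.DirEdge a b) {M' : PMG V}
    (h' : M' ∈ cls) : M'.DirEdge a b :=
  ⟨s.parr h.1 h', ((s.hP.2.2.2.2.2.2 b a).1 h.2).2 M' h'⟩
lemma pnot (s : Setup P M cls X Y Z p n) {a b : V} (h : M.DirEdge a b) : ¬ P.Arr b a :=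
  fun h' => h.not_arr (s.parr h' s.hM)
lemma meq (s : Setup P M cls X Y Z p n) {M' : PMG V} (h' : M' ∈ cls) : MarkovEquiv M M' :=
  s.hP.2.2.2.1 M s.hM M' h'
lemma madj (s : Setup P M cls X Y Z p n) {M' : PMG V} (h' : M' ∈ cls) (a b : V) :
    M.Adj a b ↔ M'.Adj a b := by
  rw [← s.padj]; exact s.hP.2.2.2.2.1 M' h' a b
lemma pdir_of (s : Setup P M cls X Y Z p n) {a b : V} (h : ∀ M' ∈ cls, M'.DirEdge a b) :
    P.DirEdge a b := by
  have hadj : P.Adj a b := s.padj.2 (h M s.hM).adj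
  exact ⟨(s.hP.2.2.2.2.2.1 a b).2 ⟨hadj, fun M' h' => (h M' h').1⟩,
    (s.hP.2.2.2.2.2.2 b a).2 ⟨hadj.sym, fun M' h' => (h M' h').2⟩⟩

lemma possDesc (s : Setup P M cls X Y Z p n) {a b : V} (h : M.Anc a b) : PossDescendant P a b := by
  obtain ⟨d, hd, hd', hh, hl⟩ := anc_iff_desc.1 h
  obtain ⟨w, hw⟩ := exists_toL d hd.1
  generalize d.length - 1 = m at hw
  subst hw
  rw [toL_isPath] at hd
  rw [toL_directed] at hd'
  exact ⟨_, toL_isPath.2 ⟨hd.1, fun k hk => s.padj.2 (hd.2 k hk)⟩,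
    toL_possDir.2 (fun k hk => s.pnot (hd' k hk)), hh, hl⟩

/-- remove the nodes strictly between positions `a` and `b`. -/
def cut (p : ℕ → V) (a b : ℕ) : ℕ → V := fun k => if k ≤ a then p k else p (k - a - 1 + b)

lemma cut_le (p : ℕ → V) {a b k : ℕ} (h : k ≤ a) : cut p a b k = p k := by simp [cut, h]
lemma cut_gt (p : ℕ → V) {a b k : ℕ} (h : a < k) : cut p a b k = p (k - a - 1 + b) := by
  simp [cut, show ¬ k ≤ a by omega]

lemma cut_rel (p : ℕ → V) {a b n k : ℕ} (hab : a < b) (R : V → V → Prop)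
    (h1 : ∀ k, k < a → R (p k) (p (k+1))) (h2 : R (p a) (p b))
    (h3 : ∀ k, b ≤ k → k < n → R (p k) (p (k+1))) (hk : k < n - (b-a-1)) :
    R (cut p a b k) (cut p a b (k+1)) := by
  rcases lt_trichotomy k a with h | h | h
  · rw [cut_le _ (by omega), cut_le _ (by omega)]; exact h1 k h
  · subst h
    rw [cut_le _ le_rfl, cut_gt _ (by omega), show k + 1 - k - 1 + b = b by omega]; exact h2
  · rw [cut_gt _ h, cut_gt _ (by omega), show k + 1 - a - 1 + b = k - a - 1 + b + 1 by omega]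
    exact h3 _ (by omega) (by omega)

lemma cut_proper (s : Setup P M cls X Y Z p n) {G : PMG V} {a b : ℕ} (hab : a < b) (hb : b ≤ n)
    (hadj : G.Adj (p a) (p b)) (hG : ∀ k, k < n → G.Adj (p k) (p (k+1))) :
    (∀ i j, i < j → j ≤ n - (b-a-1) → cut p a b i ≠ cut p a b j) ∧
      (∀ k, k < n - (b-a-1) → G.Adj (cut p a b k) (cut p a b (k+1))) ∧ cut p a b 0 ∈ X ∧
      cut p a b (n - (b-a-1)) ∈ Y ∧
      (∀ k, 1 ≤ k → k ≤ n - (b-a-1) → cut p a b k ∉ X) := by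
  refine ⟨?_, ?_, ?_, ?_, ?_⟩
  · intro i j hij hj
    by_cases h1 : j ≤ a
    · rw [cut_le _ h1, cut_le _ (by omega)]; exact s.inj _ _ hij (by omega)
    · by_cases h2 : i ≤ a
      · rw [cut_le _ h2, cut_gt _ (by omega)]; exact s.inj _ _ (by omega) (by omega)
      · rw [cut_gt _ (by omega), cut_gt _ (by omega)]; exact s.inj _ _ (by omega) (by omega)
  · intro k hk
    exact cut_rel p hab G.Adj (fun k hk => hG k (by omega)) hadj (fun k _ hk => hG k hk) hk
  · rw [cut_le _ (by omega)]; exact s.good.2.2.1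
  · rw [cut_gt _ (by omega), show n - (b-a-1) - a - 1 + b = n by omega]; exact s.good.2.2.2.1
  · intro k h1 h2
    by_cases h : k ≤ a
    · rw [cut_le _ h]; exact s.notX k h1 (by omega)
    · rw [cut_gt _ (by omega)]; exact s.notX _ (by omega) (by omega)

/-- A shortcut that remains m-connecting has to be causal. -/
lemma shortcut (s : Setup P M cls X Y Z p n) {a b : ℕ} (hab : a + 1 < b) (hb : b ≤ n)
    (hadj : M.Adj (p a) (p b)) (hA : 1 ≤ a → OK M Z (p (a-1)) (p a) (p b))
    (hB : b < n → OK M Z (p a) (p b) (p (b+1))) :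
    (∀ k, k < a → M.DirEdge (p k) (p (k+1))) ∧ M.DirEdge (p a) (p b) ∧
      ∀ k, b ≤ k → k < n → M.DirEdge (p k) (p (k+1)) := by
  obtain ⟨h1, h2, h3, h4, h5⟩ := s.cut_proper (by omega) hb hadj s.adj
  have hall : ∀ k, k < n - (b-a-1) → M.DirEdge (cut p a b k) (cut p a b (k+1)) := by
    intro k hk
    apply dir_of_not_arr s.anc (h2 k hk).sym
    intro harr
    have := s.short (cut p a b) (n-(b-a-1)) ⟨h1, h2, h3, h4, h5, ?_, k, hk, harr⟩
    · omega
    intro k hk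
    rcases lt_trichotomy (k+1) a with h | h | h
    · rw [cut_le _ (by omega), cut_le _ (by omega), cut_le _ (by omega)]; exact s.ok k (by omega)
    · subst h
      rw [cut_le _ (by omega), cut_le _ (by omega), cut_gt _ (by omega),
        show k + 2 - (k+1) - 1 + b = b by omega]
      exact hA (by omega)
    · rcases Nat.lt_or_ge a k with h' | h'
      · rw [cut_gt _ (by omega), cut_gt _ (by omega), cut_gt _ (by omega),
          show k + 1 - a - 1 + b = k - a - 1 + b + 1 by omega,
          show k + 2 - a - 1 + b = k - a - 1 + b + 2 by omega]
        exact s.ok _ (by omega)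
      · have : k = a := by omega
        subst this
        rw [cut_le _ (by omega), cut_gt _ (by omega), cut_gt _ (by omega),
          show k + 1 - k - 1 + b = b by omega,
          show k + 2 - k - 1 + b = b + 1 by omega]
        exact hB (by omega)
  refine ⟨?_, ?_, ?_⟩
  · intro k hk
    have := hall k (by omega)
    rwa [cut_le _ (by omega), cut_le _ (by omega)] at this
  · have := hall a (by omega)
    rwa [cut_le _ (by omega), cut_gt _ (by omega), show a + 1 - a - 1 + b = b by omega] at this
  · intro k hk hk'
    have := hall (k - b + a + 1) (by omega)
    rwa [cut_gt _ (by omega), cut_gt _ (by omega), show k - b + a + 1 - a - 1 + b = k by omega,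
      show k - b + a + 1 + 1 - a - 1 + b = k + 1 by omega] at this

/-- Possibly causal shortcuts: forbidden nodes and visibility. -/
lemma cut_poss (s : Setup P M cls X Y Z p n) {a b : ℕ} (hab : a < b) (hb : b ≤ n)
    (hadj : M.Adj (p a) (p b))
    (h1 : ∀ k, k < a → ¬ P.Arr (p (k+1)) (p k)) (h2 : ¬ P.Arr (p b) (p a))
    (h3 : ∀ k, b ≤ k → k < n → ¬ P.Arr (p (k+1)) (p k)) :
    (∀ k, 1 ≤ k → k ≤ n → (k ≤ a ∨ b ≤ k) → ¬ M.AncS Z (p k)) ∧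
      (a = 0 → Visible P (p 0) (p b)) := by
  have hpp := toL_proper.2 (s.cut_proper (G := P) hab hb (s.padj.2 hadj)
    (fun k hk => s.padj.2 (s.adj k hk)))
  have hpd : PossDirAlong P (toL (cut p a b) (n-(b-a-1))) :=
    toL_possDir.2 (fun k hk => cut_rel p hab (fun u v => ¬ P.Arr v u) h1 h2 h3 hk)
  constructor
  · rintro k hk hk' hor ⟨z, hz, hanc⟩
    refine s.hZ z hz ⟨p k, s.notX k hk hk', ⟨_, hpp, hpd, toL_mem.2 ?_⟩, s.possDesc hanc⟩
    rcases hor with h | h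
    · exact ⟨k, by omega, cut_le _ h⟩
    · exact ⟨k - b + a + 1, by omega, by
        rw [cut_gt _ (by omega), show k - b + a + 1 - a - 1 + b = k by omega]⟩
  · rintro rfl
    obtain ⟨u, v, hu, hv, hvis⟩ := s.hAm _ hpp hpd
    obtain ⟨_, rfl⟩ := toL_get_some hu
    obtain ⟨_, rfl⟩ := toL_get_some hv
    rwa [cut_le _ le_rfl, cut_gt _ (by omega), show 1 - 0 - 1 + b = b by omega] at hvis

end Setup

/-- A visible edge yields a collider run. -/
lemma visible_run {P : PMG V} {x y : V} (h : Visible P x y) :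
    ∃ (c : ℕ → V) (L : ℕ), 1 ≤ L ∧ c L = x ∧ c 0 ≠ y ∧ ¬ P.Adj (c 0) y ∧
      (∀ k, k + 1 ≤ L → P.Arr (c k) (c (k+1))) ∧
      (∀ k, k + 2 ≤ L → P.Arr (c (k+2)) (c (k+1))) ∧
      (∀ k, k + 2 ≤ L → P.DirEdge (c (k+1)) y) := by
  obtain ⟨_, v, hv, hna, h1 | ⟨d, ⟨hd, hh, hl, hlen⟩, hcol, ⟨a, ha, ha'⟩, hpar⟩⟩ := h
  · refine ⟨fun k => if k = 0 then v else x, 1, le_rfl, by simp, by simpa using hv,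
      by simpa using hna, ?_, ?_, ?_⟩
    · intro k hk
      have : k = 0 := by omega
      subst this
      simpa [Arr] using h1
    · intro k hk; omega
    · intro k hk; omega
  · obtain ⟨w, hw⟩ := exists_toL d hd.1
    generalize d.length - 1 = m at hw
    subst hw
    rw [toL_isPath] at hd
    rw [toL_head] at hh
    rw [toL_last] at hl
    rw [toL_length] at hlen ha hcol
    simp only [Option.some.injEq] at hh hl
    obtain ⟨_, rfl⟩ := toL_get_some ha
    subst hh hl
    refine ⟨w, m, by omega, rfl, hv, hna, ?_, ?_, ?_⟩
    · intro k hk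
      by_cases h : k + 2 ≤ m
      · exact (toL_collider.1 (hcol k (by omega))).2.1
      · rw [show m + 1 - 2 = k by omega] at ha'
        rw [show k + 1 = m by omega]; exact ha'
    · intro k hk
      exact (toL_collider.1 (hcol k (by omega))).2.2
    · intro k hk
      exact hpar _ (toL_mem.2 ⟨k+1, by omega, rfl⟩) (hd.1 0 (k+1) (by omega) (by omega)).symm
        (hd.1 (k+1) m (by omega) le_rfl)

end PMG

namespace PMG

variable {V : Type}

namespace Setup

variable {P M : PMG V} {cls : Set (PMG V)} {X Y Z : Finset V} {p : ℕ → V} {n : ℕ}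

/-- position `j` is a collider on the path. -/
def Col (M : PMG V) (p : ℕ → V) (n j : ℕ) : Prop :=
  1 ≤ j ∧ j + 1 ≤ n ∧ M.Arr (p (j-1)) (p j) ∧ M.Arr (p (j+1)) (p j)

lemma col_anc (s : Setup P M cls X Y Z p n) {j : ℕ} (h : Col M p n j) : M.AncS Z (p j) :=
  (s.ok' j h.1 h.2.1).1 h.2.2.1 h.2.2.2

lemma ancS_dir {u v : V} (h : M.DirEdge u v) (h' : M.AncS Z v) : M.AncS Z u := by
  obtain ⟨z, hz, hvz⟩ := h'
  exact ⟨z, hz, h.anc.trans hvz⟩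

/-- The triple at `a` stays fine when its right neighbour is replaced by `t`. -/
lemma ok_right (s : Setup P M cls X Y Z p n) {a : ℕ} {t : V} (h1 : 1 ≤ a) (h2 : a + 2 ≤ n)
    (hnext : Col M p n (a+1)) (hadj : M.Adj (p a) t)
    (hbad : ¬ (Col M p n a ∧ p a ∈ Z ∧ M.DirEdge (p a) t)) :
    OK M Z (p (a-1)) (p a) t := by
  have hok := s.ok' a h1 (by omega)
  constructor
  · intro c1 c2
    by_cases c3 : M.Arr (p (a+1)) (p a)
    · exact hok.1 c1 c3
    · exact ancS_dir (dir_of_not_arr s.anc (s.adj a (by omega)).sym c3) (s.col_anc hnext)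
  · intro hno hz
    by_cases hc : M.Arr (p (a-1)) (p a) ∧ M.Arr (p (a+1)) (p a)
    · exact hbad ⟨⟨h1, by omega, hc⟩, hz,
        dir_of_not_arr s.anc hadj.sym (fun h => hno ⟨hc.1, h⟩)⟩
    · exact hok.2 hc hz

/-- The triple at `b` stays fine when its left neighbour is replaced by `t`. -/
lemma ok_left (s : Setup P M cls X Y Z p n) {b : ℕ} {t : V} (h1 : 1 ≤ b) (h2 : b + 1 ≤ n)
    (hprev : Col M p n (b-1)) (hadj : M.Adj (p b) t)
    (hbad : ¬ (Col M p n b ∧ p b ∈ Z ∧ M.DirEdge (p b) t)) :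
    OK M Z t (p b) (p (b+1)) := by
  have hok := s.ok' b h1 (by omega)
  have hadj' := s.adj (b-1) (by omega)
  rw [show b - 1 + 1 = b by omega] at hadj'
  constructor
  · intro c1 c2
    by_cases c3 : M.Arr (p (b-1)) (p b)
    · exact hok.1 c3 c2
    · exact ancS_dir (dir_of_not_arr s.anc hadj' c3) (s.col_anc hprev)
  · intro hno hz
    by_cases hc : M.Arr (p (b-1)) (p b) ∧ M.Arr (p (b+1)) (p b)
    · exact hbad ⟨⟨h1, by omega, hc⟩, hz,
        dir_of_not_arr s.anc hadj.sym (fun h => hno ⟨h, hc.2⟩)⟩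
    · exact hok.2 hc hz

/-- maximal run of bad nodes to the left of `j`. -/
lemma left_run (bad : ℕ → Prop) (h0 : ¬ bad 0) {j : ℕ} (hj : 1 ≤ j) :
    ∃ i, 1 ≤ i ∧ i ≤ j ∧ (∀ k, i ≤ k → k < j → bad k) ∧ ¬ bad (i-1) := by
  classical
  have hex : ∃ i, i ≤ j ∧ ∀ k, i ≤ k → k < j → bad k := ⟨j, le_rfl, fun k h h' => by omega⟩
  obtain ⟨h1, h2⟩ := Nat.find_spec hex
  have hmin := fun m (hm : m < Nat.find hex) => Nat.find_min hex hm
  generalize Nat.find hex = i at *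
  have hi : 1 ≤ i := by
    by_contra h
    exact h0 (h2 0 (by omega) (by omega))
  refine ⟨i, hi, h1, h2, fun hb => hmin (i-1) (by omega) ⟨by omega, fun k hk hk' => ?_⟩⟩
  rcases Nat.eq_or_lt_of_le hk with h | h
  · rw [← h]; exact hb
  · exact h2 k (by omega) hk'

/-- maximal run of bad nodes to the right of `j`. -/
lemma right_run (bad : ℕ → Prop) {j n : ℕ} (hn : ¬ bad n) (hj : j < n) :
    ∃ i, j < i ∧ i ≤ n ∧ (∀ k, j < k → k < i → bad k) ∧ ¬ bad i := by
  classical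
  have hex : ∃ i, j < i ∧ ¬ bad i := ⟨n, hj, hn⟩
  obtain ⟨h1, h2⟩ := Nat.find_spec hex
  have hmin := fun m (hm : m < Nat.find hex) => Nat.find_min hex hm
  have hle := Nat.find_le (h := hex) ⟨hj, hn⟩
  generalize Nat.find hex = i at *
  refine ⟨i, h1, hle, fun k hk hk' => ?_, h2⟩
  by_contra hb
  exact hmin k hk' ⟨hk, hb⟩

/-- Left run of colliders as a `Run`. -/
lemma mkRunL {i j : ℕ} {t : V} (hi : 1 ≤ i) (hij : i ≤ j)
    (hj : Col M p n j) (hcol : ∀ k, i ≤ k → k < j → Col M p n k ∧ M.DirEdge (p k) t)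
    (hne : p (i-1) ≠ t) (hna : ¬ M.Adj (p (i-1)) t) :
    Run M (fun k => p (i - 1 + k)) (j - i + 1) t := by
  have hc : ∀ k, i ≤ k → k ≤ j → Col M p n k := by
    intro k h1 h2
    rcases Nat.eq_or_lt_of_le h2 with h | h
    · rw [h]; exact hj
    · exact (hcol k h1 h).1
  refine ⟨by omega, hne, hna, ?_, ?_, ?_⟩
  · intro k hk
    have := (hc (i+k) (by omega) (by omega)).2.2.1
    simpa only [show i + k - 1 = i - 1 + k by omega, show i - 1 + (k+1) = i + k by omega] using this
  · intro k hk
    have := (hc (i+k) (by omega) (by omega)).2.2.2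
    simpa only [show i - 1 + (k+2) = i + k + 1 by omega, show i - 1 + (k+1) = i + k by omega]
      using this
  · intro k hk
    have := (hcol (i+k) (by omega) (by omega)).2
    simpa only [show i - 1 + (k+1) = i + k by omega] using this

/-- Right run of colliders as a `Run`. -/
lemma mkRunR {i j : ℕ} {t : V} (hij : j < i)
    (hj : Col M p n j) (hcol : ∀ k, j < k → k < i → Col M p n k ∧ M.DirEdge (p k) t)
    (hne : p i ≠ t) (hna : ¬ M.Adj (p i) t) :
    Run M (fun k => p (i - k)) (i - j) t := by
  have hc : ∀ k, j ≤ k → k < i → Col M p n k := by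
    intro k h1 h2
    rcases Nat.eq_or_lt_of_le h1 with h | h
    · rw [← h]; exact hj
    · exact (hcol k h h2).1
  refine ⟨by omega, hne, hna, ?_, ?_, ?_⟩
  · intro k hk
    have := (hc (i-(k+1)) (by omega) (by omega)).2.2.2
    rwa [show i - (k+1) + 1 = i - k by omega] at this
  · intro k hk
    have := (hc (i-(k+1)) (by omega) (by omega)).2.2.1
    rwa [show i - (k+1) - 1 = i - (k+2) by omega] at this
  · intro k hk
    exact (hcol (i-(k+1)) (by omega) (by omega)).2

/-- Colliders on `p` are colliders in every MAG of the class. -/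
lemma collider_inv [Fintype V] (s : Setup P M cls X Y Z p n) {j : ℕ} (hj : Col M p n j)
    {M' : PMG V} (hM' : M' ∈ cls) :
    M'.Arr (p (j-1)) (p j) ∧ M'.Arr (p (j+1)) (p j) := by
  have hj1 := hj.1
  have hj2 := hj.2.1
  have hG := s.anc
  have hMag' := s.hP.2.1 M' hM'
  obtain ⟨i, hi, hij, hbad, hnb⟩ := left_run
    (fun k => Col M p n k ∧ p k ∈ Z ∧ M.DirEdge (p k) (p (j+1)))
    (fun h => by have := h.1.1; omega) hj1
  have hci : Col M p n i := by
    rcases Nat.eq_or_lt_of_le hij with h | h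
    · rw [h]; exact hj
    · exact (hbad i le_rfl h).1
  have hneWB : p (i-1) ≠ p (j+1) := s.inj _ _ (by omega) (by omega)
  by_cases hadj : M.Adj (p (i-1)) (p (j+1))
  swap
  · have hr := mkRunL hi hij hj (fun k h h' => ⟨(hbad k h h').1, (hbad k h h').2.2⟩) hneWB hadj
    have := run_collider s.mag hMag' (s.meq hM') (s.madj hM') hr
      (by simpa only [show i - 1 + (j-i+1) = j by omega] using hj.2.2.2)
    simpa only [show i - 1 + (j-i+1) = j by omega,
      show i - 1 + (j-i+1-1) = j - 1 by omega] using this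
  -- right-bad case
  by_cases hrb : i = j ∧ Col M p n (j+1) ∧ p (j+1) ∈ Z ∧ M.DirEdge (p (j+1)) (p (j-1))
  · obtain ⟨_, hcB, hBZ, hBA⟩ := hrb
    obtain ⟨k, hk, hkn, hbadR, hnbR⟩ := right_run
      (fun k => Col M p n k ∧ p k ∈ Z ∧ M.DirEdge (p k) (p (j-1)))
      (fun h => by have := h.1.2.1; omega) (show j < n by omega)
    have hk2 : j + 2 ≤ k := by
      by_contra h
      have : k = j + 1 := by omega
      subst this
      exact hnbR ⟨hcB, hBZ, hBA⟩
    have hneU : p k ≠ p (j-1) := (s.inj _ _ (by omega) (by omega)).symm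
    by_cases hadjU : M.Adj (p k) (p (j-1))
    swap
    · have hr := mkRunR hk hj (fun m h h' => ⟨(hbadR m h h').1, (hbadR m h h').2.2⟩) hneU hadjU
      have := run_collider s.mag hMag' (s.meq hM') (s.madj hM') hr
        (by simpa only [show k - (k-j) = j by omega] using hj.2.2.1)
      simp only [show k - (k-j) = j by omega, show k - (k-j-1) = j + 1 by omega] at this
      exact this.symm
    · exfalso
      obtain ⟨hcp, _, hdp⟩ := hbadR (k-1) (by omega) (by omega)
      have hUp : M.Arr (p k) (p (k-1)) := by
        have := hcp.2.2.2
        rwa [show k - 1 + 1 = k by omega] at this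
      have hUA : M.Arr (p k) (p (j-1)) := arr_trans hG hUp hdp.anc hadjU
      have hQA : M.Arr (p j) (p (j-1)) := by
        apply arr_of_not_anc hG hj.2.2.1.adj.sym
        intro h
        have h2 := hcB.2.2.1
        simp only [Nat.add_sub_cancel] at h2
        exact arr_not_anc hG h2 (hBA.anc.trans h)
      have := (s.shortcut (a := j-1) (b := k) (by omega) hkn hadjU.sym ?_ ?_).2.1
      · exact this.not_arr hUA
      · intro h1
        have hok := s.ok' (j-1) h1 (by omega)
        rw [show j - 1 + 1 = j by omega] at hok
        exact ⟨fun c _ => hok.1 c hQA, fun hno => hok.2 (fun h => hno ⟨h.1, hUA⟩)⟩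
      · intro h1
        exact s.ok_left (by omega) (by omega) hcp hadjU hnbR
  -- the shortcut is causal
  have hprevB : Col M p n (j + 1 - 1) := by simpa using hj
  have hcaus := s.shortcut (a := i-1) (b := j+1) (by omega) hj2 hadj
    (fun h1 => s.ok_right h1 (by omega) (by rwa [show i - 1 + 1 = i by omega]) hadj hnb)
    (by
      intro h1
      rcases Nat.eq_or_lt_of_le hij with h | h
      · refine s.ok_left (by omega) (by omega) hprevB hadj.sym ?_
        intro hb
        rw [h] at hb
        exact hrb ⟨h, hb⟩
      · obtain ⟨hcA, _, hAB⟩ := hbad (j-1) (by omega) (by omega)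
        have hAQ := hcA.2.2.2
        rw [show j - 1 + 1 = j by omega] at hAQ
        have hQB : M.Arr (p j) (p (j+1)) := by
          apply arr_of_not_anc hG hj.2.2.2.adj.sym
          intro h
          exact arr_not_anc hG hAQ (hAB.anc.trans h)
        have hWB : M.Arr (p (i-1)) (p (j+1)) :=
          arr_trans hG hci.2.2.1 (hbad i le_rfl h).2.2.anc hadj
        have hok := s.ok' (j+1) (by omega) (by omega)
        simp only [Nat.add_sub_cancel] at hok
        exact ⟨fun _ c => hok.1 hQB c, fun hno => hok.2 (fun h => hno ⟨hWB, h.2⟩)⟩)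
  obtain ⟨d1, d2, d3⟩ := hcaus
  obtain ⟨hforb, hvis⟩ := s.cut_poss (a := i-1) (b := j+1) (by omega) hj2 hadj
    (fun k hk => s.pnot (d1 k hk)) (s.pnot d2) (fun k h h' => s.pnot (d3 k h h'))
  have hi1 : i = 1 := by
    by_contra hne
    refine hforb (i-1) (by omega) (by omega) (Or.inl le_rfl) ?_
    by_cases c : M.Arr (p i) (p (i-1))
    · refine s.col_anc ⟨by omega, by omega, ?_, ?_⟩
      · have := (d1 (i-1-1) (by omega)).arr
        rwa [show i - 1 - 1 + 1 = i - 1 by omega] at this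
      · rwa [show i - 1 + 1 = i by omega]
    · exact ancS_dir (dir_of_not_arr hG hci.2.2.1.adj.sym c) (s.col_anc hci)
  subst hi1
  simp only [Nat.sub_self] at *
  have hv := hvis trivial
  by_cases hx : M.Arr (p 1) (p 0)
  · -- discriminating path through the visibility witness
    obtain ⟨c, L, hL, hcL, hc0, hcn, hcr, hcl, hcp⟩ := visible_run hv
    have hr : Run M (fun k => if k ≤ L then c k else p (k - L)) (L + j) (p (j+1)) := by
      refine ⟨by omega, by simpa using hc0, by simpa using fun h => hcn (s.padj.2 h), ?_, ?_, ?_⟩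
      · intro k hk
        by_cases h1 : k + 1 ≤ L
        · simpa [h1, show k ≤ L by omega] using s.parr (hcr k h1) s.hM
        · by_cases h2 : k = L
          · subst h2
            simpa [hcL] using hci.2.2.1
          · have : Col M p n (k+1-L) := by
              by_cases h3 : k + 1 - L = j
              · rw [h3]; exact hj
              · exact (hbad _ (by omega) (by omega)).1
            have := this.2.2.1
            rw [show k + 1 - L - 1 = k - L by omega] at this
            simpa [h1, show ¬ k ≤ L by omega] using this
      · intro k hk
        by_cases h1 : k + 2 ≤ L
        · simpa [h1, show k + 1 ≤ L by omega] using s.parr (hcl k h1) s.hM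
        · by_cases h2 : k + 1 = L
          · subst h2
            simpa [hcL] using hx
          · have := (hbad (k+1-L) (by omega) (by omega)).1.2.2.2
            rw [show k + 1 - L + 1 = k + 2 - L by omega] at this
            simpa [h1, show ¬ k + 1 ≤ L by omega] using this
      · intro k hk
        by_cases h1 : k + 2 ≤ L
        · simpa [show k + 1 ≤ L by omega] using s.pdir (hcp k h1) s.hM
        · by_cases h2 : k + 1 = L
          · subst h2
            simpa [hcL] using d2
          · have := (hbad (k+1-L) (by omega) (by omega)).2.2
            simpa [show ¬ k + 1 ≤ L by omega] using this
    have := run_collider s.mag hMag' (s.meq hM') (s.madj hM') hr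
      (by simpa [show ¬ L + j ≤ L by omega] using hj.2.2.2)
    have e : (if L + j - 1 ≤ L then c (L + j - 1) else p (L + j - 1 - L)) = p (j-1) := by
      by_cases h1 : j = 1
      · subst h1; simp [hcL]
      · rw [if_neg (by omega), show L + j - 1 - L = j - 1 by omega]
    simp only [e, if_neg (show ¬ L + j ≤ L by omega), Nat.add_sub_cancel_left] at this
    exact this
  · have hx1 := dir_of_not_arr hG hci.2.2.1.adj.sym hx
    by_cases h1 : j = 1
    · subst h1
      have hPQ : P.Arr (p 2) (p 1) := by
        by_contra hno
        refine (s.cut_poss (a := 0) (b := 1) (by omega) (by omega) hx1.adj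
          (fun k hk => by omega) (s.pnot hx1) ?_).1 1 le_rfl (by omega) (Or.inr le_rfl)
          (s.col_anc hj)
        intro k hk hk'
        rcases Nat.eq_or_lt_of_le hk with h | h
        · rw [← h]; exact hno
        · exact s.pnot (d3 k (by omega) hk')
      have hBQ := s.parr hPQ hM'
      refine ⟨?_, hBQ⟩
      apply arr_of_not_anc hMag'.1 ((s.madj hM' _ _).1 hx1.adj)
      intro h
      exact arr_not_anc hMag'.1 hBQ (h.trans (s.pdir hv.1 hM').anc)
    · exfalso
      obtain ⟨hc1, hz1, hd1⟩ := hbad 1 le_rfl (by omega)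
      refine (s.cut_poss (a := 1) (b := j+1) (by omega) hj2 hd1.adj
        (fun k hk => ?_) (s.pnot hd1) (fun k h h' => s.pnot (d3 k h h'))).1 1 le_rfl (by omega)
        (Or.inl le_rfl) ⟨_, hz1, .refl⟩
      have : k = 0 := by omega
      subst this
      exact s.pnot hx1

end Setup

end PMG

namespace PMG

variable {V : Type}

namespace Setup

variable {P M : PMG V} {cls : Set (PMG V)} {X Y Z : Finset V} {p : ℕ → V} {n : ℕ}

/-- replace the nodes strictly between positions `a` and `b` by `t`. -/
def ins (p : ℕ → V) (a : ℕ) (t : V) (b : ℕ) : ℕ → V :=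
  fun k => if k ≤ a then p k else if k = a + 1 then t else p (k - a - 2 + b)

lemma ins_le (p : ℕ → V) {a b k : ℕ} {t : V} (h : k ≤ a) : ins p a t b k = p k := by simp [ins, h]
lemma ins_mid (p : ℕ → V) {a b k : ℕ} {t : V} (h : k = a + 1) : ins p a t b k = t := by
  simp [ins, h]
lemma ins_gt (p : ℕ → V) {a b k : ℕ} {t : V} (h : a + 1 < k) :
    ins p a t b k = p (k - a - 2 + b) := by
  simp [ins, show ¬ k ≤ a by omega, show k ≠ a + 1 by omega]

lemma ins_good (s : Setup P M cls X Y Z p n) {a b : ℕ} {t : V} (hab : a < b) (hb : b ≤ n)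
    (ht : ∀ m, m ≤ n → p m ≠ t) (htX : t ∉ X) (htZ : M.AncS Z t)
    (h1 : M.Arr (p a) t) (h2 : M.Arr (p b) t)
    (hA : 1 ≤ a → OK M Z (p (a-1)) (p a) t) (hB : b < n → OK M Z t (p b) (p (b+1))) :
    Good M X Y Z (ins p a t b) (n - (b-a) + 2) := by
  refine ⟨?_, ?_, ?_, ?_, ?_, ?_, a+1, by omega, ?_⟩
  · intro i j hij hj
    rcases lt_trichotomy j (a+1) with h | h | h
    · rw [ins_le _ (by omega), ins_le _ (by omega)]; exact s.inj _ _ hij (by omega)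
    · rw [ins_mid _ h, ins_le _ (by omega)]; exact ht _ (by omega)
    · rw [ins_gt _ h]
      rcases lt_trichotomy i (a+1) with h' | h' | h'
      · rw [ins_le _ (by omega)]; exact s.inj _ _ (by omega) (by omega)
      · rw [ins_mid _ h']; exact (ht _ (by omega)).symm
      · rw [ins_gt _ h']; exact s.inj _ _ (by omega) (by omega)
  · intro k hk
    rcases lt_trichotomy k (a+1) with h | h | h
    · by_cases h' : k = a
      · subst h'
        rw [ins_le _ le_rfl, ins_mid _ rfl]; exact h1.adj
      · rw [ins_le _ (by omega), ins_le _ (by omega)]; exact s.adj k (by omega)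
    · rw [ins_mid _ h, ins_gt _ (by omega), show k + 1 - a - 2 + b = b by omega]
      exact h2.adj.sym
    · rw [ins_gt _ h, ins_gt _ (by omega), show k + 1 - a - 2 + b = k - a - 2 + b + 1 by omega]
      exact s.adj _ (by omega)
  · rw [ins_le _ (by omega)]; exact s.good.2.2.1
  · rw [ins_gt _ (by omega), show n - (b-a) + 2 - a - 2 + b = n by omega]; exact s.good.2.2.2.1
  · intro k hk hk'
    rcases lt_trichotomy k (a+1) with h | h | h
    · rw [ins_le _ (by omega)]; exact s.notX k hk (by omega)
    · rw [ins_mid _ h]; exact htX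
    · rw [ins_gt _ h]; exact s.notX _ (by omega) (by omega)
  · intro k hk
    rcases lt_trichotomy (k+1) (a+1) with h | h | h
    · by_cases h' : k + 1 = a
      · subst h'
        rw [ins_le _ (by omega), ins_le _ le_rfl, ins_mid _ rfl]; exact hA (by omega)
      · rw [ins_le _ (by omega), ins_le _ (by omega), ins_le _ (by omega)]; exact s.ok k (by omega)
    · have h' : k = a := by omega
      subst h'
      rw [ins_le _ le_rfl, ins_mid _ rfl, ins_gt _ (by omega),
        show k + 2 - k - 2 + b = b by omega]
      exact ⟨fun _ _ => htZ, fun hno => absurd ⟨h1, h2⟩ hno⟩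
    · by_cases h' : k = a + 1
      · rw [ins_mid _ h', ins_gt _ (by omega), ins_gt _ (by omega),
          show k + 1 - a - 2 + b = b by omega, show k + 2 - a - 2 + b = b + 1 by omega]
        exact hB (by omega)
      · rw [ins_gt _ (by omega), ins_gt _ (by omega), ins_gt _ (by omega),
          show k + 1 - a - 2 + b = k - a - 2 + b + 1 by omega,
          show k + 2 - a - 2 + b = k - a - 2 + b + 2 by omega]
        exact s.ok _ (by omega)
  · rw [ins_mid _ rfl, ins_gt _ (by omega), show a + 1 + 1 - a - 2 + b = b by omega]; exact h2

/-- The child `S` of a collider towards `Z` is not on `p`. -/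
lemma child_not_on (s : Setup P M cls X Y Z p n) {j : ℕ} (hj : Col M p n j) {S : V}
    (hQZ : p j ∉ Z) (hQS : M.DirEdge (p j) S) (hSZ : M.AncS Z S) :
    ∀ m, m ≤ n → p m ≠ S := by
  have hj1 := hj.1
  have hj2 := hj.2.1
  have hG := s.anc
  rintro m hm rfl
  have hne1 : m ≠ j - 1 := by
    rintro rfl; exact hQS.not_arr hj.2.2.1
  have hne2 : m ≠ j + 1 := by
    rintro rfl; exact hQS.not_arr hj.2.2.2
  have hne3 : m ≠ j := by
    rintro rfl; exact hQS.adj.ne rfl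
  by_cases hmj : m < j
  · refine ((s.shortcut (a := m) (b := j) (by omega) (by omega) hQS.adj.sym ?_ ?_).2.1).not_arr
      hQS.arr
    · intro h1
      exact ⟨fun _ _ => hSZ, fun hno => (s.ok' m h1 (by omega)).2 (fun h => hno ⟨h.1, hQS.arr⟩)⟩
    · intro h1
      exact ⟨fun h => absurd h hQS.not_arr, fun _ => hQZ⟩
  · obtain ⟨d1, d2, d3⟩ := s.shortcut (a := j) (b := m) (by omega) (by omega) hQS.adj
      (fun h1 => ⟨fun _ h => absurd h hQS.not_arr, fun _ => hQZ⟩)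
      (fun h1 => ⟨fun _ _ => hSZ,
        fun hno => (s.ok' m (by omega) (by omega)).2 (fun h => hno ⟨hQS.arr, h.2⟩)⟩)
    exact (s.cut_poss (a := j) (b := m) (by omega) hm hQS.adj (fun k hk => s.pnot (d1 k hk))
      (s.pnot d2) (fun k h h' => s.pnot (d3 k h h'))).1 j hj1 (by omega) (Or.inl le_rfl)
      (s.col_anc hj)

/-- The child `S` of a collider towards `Z` is not in `X`. -/
lemma child_not_X (s : Setup P M cls X Y Z p n) {j : ℕ} (hj : Col M p n j) {S : V}
    (hQZ : p j ∉ Z) (hQS : M.DirEdge (p j) S) (hS : ∀ m, m ≤ n → p m ≠ S)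
    (hlt : distZ M Z S < distZ M Z (p j)) : S ∉ X := by
  have hj1 := hj.1
  have hj2 := hj.2.1
  intro hX
  have hgood : Good M X Y Z (fun x => if x = 0 then S else p (x + j - 1)) (n - j + 1) := by
    refine ⟨?_, ?_, by simpa using hX, ?_, ?_, ?_, 0, by omega, ?_⟩
    · intro a b hab hb
      by_cases h : a = 0
      · simpa [h, show b ≠ 0 by omega] using (hS _ (by omega)).symm
      · simpa [h, show b ≠ 0 by omega] using s.inj _ _ (by omega) (by omega)
    · intro k hk
      by_cases h : k = 0
      · subst h
        simpa [show 1 + j - 1 = j by omega] using hQS.adj.sym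
      · simpa [h, show k + 1 + j - 1 = k + j - 1 + 1 by omega] using s.adj (k+j-1) (by omega)
    · simpa [show n - j + 1 + j - 1 = n by omega] using s.good.2.2.2.1
    · intro k hk hk'
      simpa [show k ≠ 0 by omega] using s.notX (k+j-1) (by omega) (by omega)
    · intro k hk
      by_cases h : k = 0
      · subst h
        simp only [if_true, Nat.zero_add, if_neg (show (1:ℕ) ≠ 0 by omega),
          if_neg (show (2:ℕ) ≠ 0 by omega), show 1 + j - 1 = j by omega]
        exact ⟨fun h => absurd h hQS.not_arr, fun _ => hQZ⟩
      · simpa [h, show k + 1 + j - 1 = k + j - 1 + 1 by omega,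
          show k + 2 + j - 1 = k + j - 1 + 2 by omega] using s.ok (k+j-1) (by omega)
    · simpa [show 1 + j - 1 = j by omega] using hQS.arr
  have h1 := s.short _ _ hgood
  have h2 : j = 1 := by omega
  subst h2
  rw [show n - 1 + 1 = n by omega] at hgood
  have h3 := s.dist _ hgood
  refine absurd h3 (not_le.2 ?_)
  unfold dsum
  apply Finset.sum_lt_sum
  · intro i hi
    by_cases h : i = 0
    · subst h
      rw [if_neg]
      · exact Nat.zero_le _
      · rintro ⟨_, h, _⟩
        exact hQS.not_arr (by simpa using h)
    · simp [h]
  · refine ⟨0, by simp, ?_⟩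
    rw [if_neg, if_pos ⟨hj2, hj.2.2⟩]
    · simpa using (Nat.zero_le _).trans_lt hlt
    · rintro ⟨_, h, _⟩
      exact hQS.not_arr (by simpa using h)

/-- The first edge of a shortest directed path from a collider to `Z` is invariant. -/
lemma first_edge [Fintype V] (s : Setup P M cls X Y Z p n) {j : ℕ} (hj : Col M p n j) {S : V}
    (hQZ : p j ∉ Z) (hQS : M.DirEdge (p j) S) (hSZ : M.AncS Z S)
    (hlt : distZ M Z S < distZ M Z (p j)) {M' : PMG V} (hM' : M' ∈ cls) :
    M'.DirEdge (p j) S := by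
  have hj1 := hj.1
  have hj2 := hj.2.1
  have hG := s.anc
  have hMag' := s.hP.2.1 M' hM'
  have hS := s.child_not_on hj hQZ hQS hSZ
  have hSX := s.child_not_X hj hQZ hQS hS hlt
  obtain ⟨i, hi, hij, hbadL, hnL⟩ := left_run
    (fun k => Col M p n k ∧ p k ∈ Z ∧ M.DirEdge (p k) S)
    (fun h => by have := h.1.1; omega) hj1
  obtain ⟨b, hb, hbn, hbadR, hnR⟩ := right_run
    (fun k => Col M p n k ∧ p k ∈ Z ∧ M.DirEdge (p k) S)
    (fun h => by have := h.1.2.1; omega) (show j < n by omega)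
  have hcL : ∀ k, i ≤ k → k ≤ j → Col M p n k ∧ M.DirEdge (p k) S := by
    intro k h1 h2
    rcases Nat.eq_or_lt_of_le h2 with h | h
    · rw [h]; exact ⟨hj, hQS⟩
    · exact ⟨(hbadL k h1 h).1, (hbadL k h1 h).2.2⟩
  have hcR : ∀ k, j ≤ k → k < b → Col M p n k ∧ M.DirEdge (p k) S := by
    intro k h1 h2
    rcases Nat.eq_or_lt_of_le h1 with h | h
    · rw [← h]; exact ⟨hj, hQS⟩
    · exact ⟨(hbadR k h h2).1, (hbadR k h h2).2.2⟩
  by_cases hadjL : M.Adj (p (i-1)) S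
  swap
  · have hr := mkRunL hi hij hj (fun k h h' => hcL k h (by omega)) (hS _ (by omega)) hadjL
    have := run_noncollider s.mag hMag' (s.meq hM') (s.madj hM') hr
      (by simpa only [show i - 1 + (j-i+1) = j by omega] using hQS) ?_ ?_
    · simpa only [show i - 1 + (j-i+1) = j by omega] using this
    · intro k hk
      have := (s.collider_inv (hcL (i+k) (by omega) (by omega)).1 hM').1
      simpa only [show i + k - 1 = i - 1 + k by omega,
        show i - 1 + (k+1) = i + k by omega] using this
    · intro k hk
      have := (s.collider_inv (hcL (i+k) (by omega) (by omega)).1 hM').2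
      simpa only [show i - 1 + (k+2) = i + k + 1 by omega, show i - 1 + (k+1) = i + k by omega]
        using this
  by_cases hadjR : M.Adj (p b) S
  swap
  · have hr := mkRunR hb hj (fun k h h' => hcR k (by omega) h') (hS _ (by omega)) hadjR
    have := run_noncollider s.mag hMag' (s.meq hM') (s.madj hM') hr
      (by simpa only [show b - (b-j) = j by omega] using hQS) ?_ ?_
    · simpa only [show b - (b-j) = j by omega] using this
    · intro k hk
      have := (s.collider_inv (hcR (b-(k+1)) (by omega) (by omega)).1 hM').2
      rwa [show b - (k+1) + 1 = b - k by omega] at this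
    · intro k hk
      have := (s.collider_inv (hcR (b-(k+1)) (by omega) (by omega)).1 hM').1
      rwa [show b - (k+1) - 1 = b - (k+2) by omega] at this
  exfalso
  have hci := hcL i le_rfl hij
  have hcb := hcR (b-1) (by omega) (by omega)
  have hWS : M.Arr (p (i-1)) S := arr_trans hG hci.1.2.2.1 hci.2.anc hadjL
  have hUS : M.Arr (p b) S := by
    have := hcb.1.2.2.2
    rw [show b - 1 + 1 = b by omega] at this
    exact arr_trans hG this hcb.2.anc hadjR
  have hgood := s.ins_good (a := i-1) (b := b) (by omega) hbn hS hSX hSZ hWS hUS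
    (fun h1 => s.ok_right h1 (by omega) (by rw [show i - 1 + 1 = i by omega]; exact hci.1)
      hadjL hnL)
    (fun h1 => s.ok_left (by omega) (by omega) hcb.1 hadjR hnR)
  have h1 := s.short _ _ hgood
  have hi' : i = j := by omega
  have hb' : b = j + 1 := by omega
  subst hi' hb'
  rw [show n - (i + 1 - (i-1)) + 2 = n by omega] at hgood
  have h3 := s.dist _ hgood
  have hq : ∀ x, x ≠ i → ins p (i-1) S (i+1) x = p x := by
    intro x hx
    by_cases h : x < i
    · exact ins_le _ (by omega)
    · rw [ins_gt _ (by omega)]; congr 1; omega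
  have hqi : ins p (i-1) S (i+1) i = S := ins_mid _ (by omega)
  generalize ins p (i-1) S (i+1) = q at *
  refine absurd h3 (not_le.2 ?_)
  unfold dsum
  have hat : i - 1 + 2 ≤ n ∧ M.Arr (p (i-1)) (p (i-1+1)) ∧ M.Arr (p (i-1+2)) (p (i-1+1)) := by
    rw [show i - 1 + 1 = i by omega, show i - 1 + 2 = i + 1 by omega]
    exact ⟨hj2, hj.2.2⟩
  apply Finset.sum_lt_sum
  · intro x hx
    by_cases h : x = i - 1
    · subst h
      rw [if_pos hat]
      rw [show i - 1 + 1 = i by omega, hqi]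
      split_ifs
      · exact hlt.le
      · exact Nat.zero_le _
    · rw [hq (x+1) (by omega)]
      split_ifs with c1 c2 c2
      · exact le_rfl
      · exfalso
        apply c2
        obtain ⟨e1, e2, e3⟩ := c1
        refine ⟨e1, ?_, ?_⟩
        · by_cases h' : x = i
          · subst h'
            rw [hqi] at e2
            apply arr_of_not_anc hG (s.adj x (by omega))
            intro ha
            exact arr_not_anc hG e2 (ha.trans hQS.anc)
          · rwa [hq x h'] at e2
        · by_cases h' : x + 2 = i
          · subst h'
            rw [hqi] at e3
            apply arr_of_not_anc hG (s.adj (x+1) (by omega)).sym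
            intro ha
            exact arr_not_anc hG e3 (ha.trans hQS.anc)
          · rwa [hq _ h'] at e3
      · exact Nat.zero_le _
      · exact le_rfl
  · refine ⟨i-1, by simp; omega, ?_⟩
    rw [if_pos hat]
    rw [show i - 1 + 1 = i by omega, hqi]
    split_ifs
    · exact hlt
    · exact (Nat.zero_le _).trans_lt hlt

end Setup

end PMG

namespace PMG

variable {V : Type} {P M : PMG V} {cls : Set (PMG V)} {X Y Z : Finset V} {p : ℕ → V} {n : ℕ}

lemma Setup.directed [Fintype V] (s : Setup P M cls X Y Z p n) {j : ℕ} (hj : Setup.Col M p n j)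
    {e : ℕ → V} {m : ℕ} (he0 : e 0 = p j) (hez : e m ∈ Z)
    (hpath : IsPath M (toL e m)) (hdir : DirectedAlong M (toL e m))
    (hmin : ∀ d' : List V, IsPath M d' → DirectedAlong M d' → d'.head? = some (p j) →
          (∃ z ∈ Z, d'.getLast? = some z) → (toL e m).length ≤ d'.length) :
    DirectedAlong P (toL e m) := by
  have hp := toL_isPath.1 hpath
  have hd := toL_directed.1 hdir
  rw [toL_length] at hmin
  rw [toL_directed]
  have hdist : 1 ≤ m → distZ M Z (e 1) < distZ M Z (p j) := by
    intro hm
    have h1 : distZ M Z (e 1) ≤ m - 1 := by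
      apply Nat.sInf_le
      refine ⟨toL (fun k => e (k+1)) (m-1), toL_isPath.2 ⟨fun a b hab hb => hp.1 _ _ (by omega) (by omega),
        fun k hk => hp.2 (k+1) (by omega)⟩, toL_directed.2 (fun k hk => hd (k+1) (by omega)),
        toL_head _ _, ⟨e m, hez, ?_⟩, toL_length _ _⟩
      rw [toL_last, show m - 1 + 1 = m by omega]
    have h2 : m ≤ distZ M Z (p j) := by
      unfold distZ
      apply le_csInf
      · exact ⟨m, toL e m, hpath, hdir, by rw [toL_head, he0], ⟨e m, hez, toL_last _ _⟩, toL_length _ _⟩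
      · rintro b ⟨q, h1, h2, h3, h4, h5⟩
        have := hmin q h1 h2 h3 h4
        omega
    omega
  have key : ∀ k, k < m → ∀ M' ∈ cls, M'.DirEdge (e k) (e (k+1)) := by
    intro k
    induction k with
    | zero =>
      intro hk M' hM'
      have hanc : ∀ i, i + 1 ≤ m → M.Anc (e 1) (e (i+1)) := by
        intro i
        induction i with
        | zero => intro _; exact Relation.ReflTransGen.refl
        | succ i ih => intro hi; exact (ih (by omega)).trans (hd (i+1) (by omega)).anc
      have hQZ : p j ∉ Z := by
        intro hz
        have := hmin (toL (fun _ => p j) 0)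
          (toL_isPath.2 ⟨fun a b _ _ => by omega, fun k hk => by omega⟩)
          (toL_directed.2 (fun k hk => by omega)) (toL_head _ _) ⟨p j, hz, toL_last _ _⟩
        rw [toL_length] at this
        omega
      have h0 := hd 0 hk
      rw [he0] at h0 ⊢
      refine s.first_edge hj hQZ h0 ⟨e m, hez, ?_⟩ (hdist (by omega)) hM'
      have := hanc (m-1) (by omega)
      rwa [show m - 1 + 1 = m by omega] at this
    | succ k ih =>
      intro hk M' hM'
      have ih' := ih (by omega) M' hM'
      have hna : ¬ M.Adj (e k) (e (k+2)) := by
        intro hadj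
        have hdk := dir_of_anc s.anc ((hd k (by omega)).anc.trans (hd (k+1) (by omega)).anc) hadj
        set f : ℕ → V := fun x => e (if x ≤ k then x else x + 1) with hf
        have hfd : ∀ x, x < m - 1 → M.DirEdge (f x) (f (x+1)) := by
          intro x hx
          simp only [hf]
          rcases lt_trichotomy x k with h | h | h
          · rw [if_pos (by omega), if_pos (by omega)]; exact hd x (by omega)
          · subst h
            rw [if_pos le_rfl, if_neg (by omega)]; exact hdk
          · rw [if_neg (by omega), if_neg (by omega)]; exact hd (x+1) (by omega)
        have := hmin (toL f (m-1)) (toL_isPath.2 ⟨?_, fun x hx => (hfd x hx).adj⟩)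
          (toL_directed.2 hfd) (by rw [toL_head, ← he0]; simp [hf])
          ⟨e m, hez, by
            rw [toL_last]; simp only [hf]
            rw [if_neg (by omega), show m - 1 + 1 = m by omega]⟩
        · rw [toL_length] at this; omega
        · intro a b hab hb
          apply hp.1 <;> split_ifs <;> omega
      have hr : Run M (fun x => e (k+x)) 1 (e (k+2)) := by
        refine ⟨le_rfl, hp.1 k (k+2) (by omega) (by omega), hna, ?_, ?_, ?_⟩
        · intro x hx
          obtain rfl : x = 0 := by omega
          exact (hd k (by omega)).arr
        · intro x hx; omega
        · intro x hx; omega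
      refine run_noncollider (w := fun x => e (k+x)) (N := 1) (S := e (k+2)) s.mag (s.hP.2.1 M' hM')
        (s.meq hM') (s.madj hM') hr
        (hd (k+1) hk) ?_ ?_
      · intro x hx
        obtain rfl : x = 0 := by omega
        exact ih'.arr
      · intro x hx; omega
  exact fun k hk => s.pdir_of (key k hk)

end PMG

open PMG in
/-- For a shortest proper non-causal m-connecting path `p` in a MAG `M` (with minimal
distance-from-`Z`), every shortest directed path in `M` from a collider on `p` to `Z`
is directed in the PAG `P` as well; consequently every collider on the corresponding
path in `P` has a descendant in `Z` in `P`. -/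
theorem collider_to_Z_paths_directed_in_pag {V : Type} [Fintype V] [DecidableEq V]
    (P : PMG V) (cls : Set (PMG V)) (hP : IsPAGOf P cls)
    (M : PMG V) (hM : M ∈ cls) (X Y Z : Finset V)
    (hXY : Disjoint X Y) (hXZ : Disjoint X Z) (hYZ : Disjoint Y Z)
    (hX : X.Nonempty) (hY : Y.Nonempty)
    (hAm : Amenable P (Visible P) X Y)
    (hZforb : ∀ z ∈ Z, z ∉ Forb P X Y)
    (p : List V)
    (hprop : ProperPath M X Y p) (hnc : ¬ PossDirAlong M p) (hmc : MConn M Z p)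
    (hshort : ∀ q, ProperPath M X Y q → ¬ PossDirAlong M q → MConn M Z q →
      p.length ≤ q.length)
    (hdist : ∀ q, ProperPath M X Y q → ¬ PossDirAlong M q → MConn M Z q →
      q.length = p.length → pathDistZ M Z p ≤ pathDistZ M Z q) :
    (∀ i q, ColliderAt M p i → p[i+1]? = some q →
      ∀ d : List V, IsPath M d → DirectedAlong M d → d.head? = some q →
        (∃ z ∈ Z, d.getLast? = some z) →
        (∀ d' : List V, IsPath M d' → DirectedAlong M d' → d'.head? = some q →
          (∃ z ∈ Z, d'.getLast? = some z) → d.length ≤ d'.length) →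
        DirectedAlong P d) ∧
    (∀ i q, ColliderAt P p i → p[i+1]? = some q → ∃ z ∈ Z, Descendant P q z) := by

  have hMag : IsMAG M := hP.2.1 M hM
  obtain ⟨w, hw⟩ := exists_toL p hprop.1.1
  generalize p.length - 1 = n at hw
  subst hw
  have s : Setup P M cls X Y Z w n := by
    refine ⟨hP, hM, hAm, hZforb, (good_iff hMag.1).2 ⟨hprop, hnc, hmc⟩, ?_, ?_⟩
    · intro q m hq
      obtain ⟨h1, h2, h3⟩ := (good_iff hMag.1).1 hq
      have := hshort _ h1 h2 h3
      rw [toL_length, toL_length] at this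
      omega
    · intro q hq
      obtain ⟨h1, h2, h3⟩ := (good_iff hMag.1).1 hq
      have := hdist _ h1 h2 h3 (by rw [toL_length, toL_length])
      rwa [pathDist_eq, pathDist_eq] at this
  have first : ∀ i q, ColliderAt M (toL w n) i → (toL w n)[i+1]? = some q →
      ∀ d : List V, IsPath M d → DirectedAlong M d → d.head? = some q →
        (∃ z ∈ Z, d.getLast? = some z) →
        (∀ d' : List V, IsPath M d' → DirectedAlong M d' → d'.head? = some q →
          (∃ z ∈ Z, d'.getLast? = some z) → d.length ≤ d'.length) →
        DirectedAlong P d := by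
    intro i q hc hq d hd hdd hh hl hmin
    obtain ⟨hi, h1, h2⟩ := toL_collider.1 hc
    obtain ⟨_, rfl⟩ := toL_get_some hq
    obtain ⟨e, he⟩ := exists_toL d hd.1
    generalize d.length - 1 = m at he
    subst he
    rw [toL_head] at hh
    obtain ⟨z, hz, hl⟩ := hl
    rw [toL_last] at hl
    simp only [Option.some.injEq] at hh hl
    subst hl
    exact s.directed (j := i+1) ⟨by omega, by omega, h1, h2⟩ hh hz hd hdd hmin
  refine ⟨first, ?_⟩
  intro i q hc hq
  have hcM : ColliderAt M (toL w n) i := by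
    obtain ⟨hi, h1, h2⟩ := toL_collider.1 hc
    exact toL_collider.2 ⟨hi, s.parr h1 hM, s.parr h2 hM⟩
  obtain ⟨z, hz, d, hd1, hd2, hd3, hd4⟩ := hmc.2.2 i q hq hcM
  classical
  have hex : ∃ l, ∃ d : List V, IsPath M d ∧ DirectedAlong M d ∧ d.head? = some q ∧
      (∃ z ∈ Z, d.getLast? = some z) ∧ d.length = l :=
    ⟨_, d, hd1, hd2, hd3, ⟨z, hz, hd4⟩, rfl⟩
  obtain ⟨d0, h1, h2, h3, h4, h5⟩ := Nat.find_spec hex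
  have hdir := first i q hcM hq d0 h1 h2 h3 h4 (by
    intro d' a1 a2 a3 a4
    rw [h5]
    exact Nat.find_min' hex ⟨d', a1, a2, a3, a4, rfl⟩)
  obtain ⟨z0, hz0, h4⟩ := h4
  refine ⟨z0, hz0, d0, ?_, hdir, h3, h4⟩
  obtain ⟨e, he⟩ := exists_toL d0 h1.1
  rw [he] at h1 ⊢
  rw [toL_isPath] at h1 ⊢
  exact ⟨h1.1, fun k hk => s.padj.2 (h1.2 k hk)⟩
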